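/- arXiv:2002.01748 — 2 statements merged into one kernel-verified Lean document; each statement's English description precedes it below -/
import Mathlib

section
/- If s_1 = ... = s_{kr-1} = 1 and s_{kr} = ... = s_n = r-1, with n ≥ rk, then χ(KG^r_S(n,k)) = n - rk + 2. -/
open Finset

/-- A coloring of the vertices is proper if no edge is monochromatic. -/
def IsProperColoring {V : Type*} (E : Set (Multiset V)) {t : ℕ} (c : V → Fin t) : Prop :=
  ∀ e ∈ E, ∃ a ∈ e, ∃ b ∈ e, c a ≠ c b

/-- The chromatic number of a hypergraph with edge set `E`, as an extended natural number
(infinity if no proper coloring exists, e.g. in the presence of a loop edge). -/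
noncomputable def hypChromatic {V : Type*} (E : Set (Multiset V)) : ℕ∞ :=
  sInf {N : ℕ∞ | ∃ t : ℕ, N = (t : ℕ∞) ∧ ∃ c : V → Fin t, IsProperColoring E c}

/-- Vertices of `KG^r_S(n,k)`: the `k`-subsets of `[n]`. -/
def KGSVertex (n k : ℕ) : Type :=
  {A : Finset (Fin n) // A.card = k}

/-- Edges of `KG^r_S(n,k)`: multisets `{A_1, …, A_r}` of `k`-subsets that are `S`-disjoint,
i.e. each `i ∈ [n]` belongs to at most `s i` of the sets. -/
def KGSEdges (n k r : ℕ) (s : Fin n → ℕ) : Set (Multiset (KGSVertex n k)) :=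
  {e | Multiset.card e = r ∧ ∀ x : Fin n, (e.filter fun A => x ∈ A.1).card ≤ s x}

namespace ZpTucker

/-- Augmented ordered chains on a vertex type `V`: formal combinations of lists of vertices. -/
abbrev Chains (K V : Type*) [CommRing K] := List V →₀ K

section Chains

variable {K V : Type*} [CommRing K]

/-- The cone operator: put the vertex `a` in front. -/
noncomputable def cone (a : V) : Chains K V →ₗ[K] Chains K V :=
  Finsupp.lmapDomain K K (List.cons a)

/-- The boundary of a single list. -/
noncomputable def bdList (K : Type*) {V : Type*} [CommRing K] : List V → Chains K V
  | [] => 0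
  | a :: l => Finsupp.single l 1 - cone a (bdList K l)

/-- The augmented boundary operator. -/
noncomputable def bd : Chains K V →ₗ[K] Chains K V :=
  Finsupp.linearCombination K (bdList K)

/-- The operator on chains induced by a map of vertices. -/
noncomputable def push (s : V → V) : Chains K V →ₗ[K] Chains K V :=
  Finsupp.lmapDomain K K (List.map s)

@[simp] lemma cone_single (a : V) (l : List V) (x : K) :
    cone a (Finsupp.single l x) = Finsupp.single (a :: l) x := by
  simp [cone, Finsupp.mapDomain_single]

@[simp] lemma push_single (s : V → V) (l : List V) (x : K) :
    push s (Finsupp.single l x) = Finsupp.single (l.map s) x := by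
  simp [push, Finsupp.mapDomain_single]

@[simp] lemma bd_single (l : List V) (x : K) :
    bd (Finsupp.single l x) = x • bdList K l := by
  simp [bd, Finsupp.linearCombination_single]

lemma bd_cone (a : V) (z : Chains K V) : bd (cone a z) = z - cone a (bd z) := by
  have : bd ∘ₗ cone a = LinearMap.id - cone a ∘ₗ (bd : Chains K V →ₗ[K] Chains K V) := by
    ext l : 2
    simp [bdList]
  exact LinearMap.congr_fun this z

lemma bd_bdList (l : List V) : bd (bdList K l) = 0 := by
  induction l with
  | nil => simp [bdList]
  | cons a l ih => simp [bdList, bd_cone, ih]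

lemma bd_bd (z : Chains K V) : bd (bd z) = 0 := by
  have : bd ∘ₗ bd = (0 : Chains K V →ₗ[K] Chains K V) := by
    ext l : 2
    simp [bd_bdList]
  exact LinearMap.congr_fun this z

lemma push_cone (s : V → V) (a : V) (z : Chains K V) :
    push s (cone a z) = cone (s a) (push s z) := by
  have : push s ∘ₗ cone a = cone (s a) ∘ₗ (push s : Chains K V →ₗ[K] Chains K V) := by
    ext l : 2
    simp
  exact LinearMap.congr_fun this z

lemma push_bdList (s : V → V) (l : List V) :
    push s (bdList K l) = bdList K (l.map s) := by
  induction l with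
  | nil => simp [bdList]
  | cons a l ih => simp [bdList, push_cone, ih]

lemma push_bd (s : V → V) (z : Chains K V) : push s (bd z) = bd (push s z) := by
  have : push s ∘ₗ bd = bd ∘ₗ (push s : Chains K V →ₗ[K] Chains K V) := by
    ext l : 2
    simp [push_bdList]
  exact LinearMap.congr_fun this z

/-- The chains supported on lists satisfying `T`. -/
noncomputable def chainsOn (K : Type*) {V : Type*} [CommRing K] (T : List V → Prop) :
    Submodule K (Chains K V) :=
  Submodule.span K ((fun l => Finsupp.single l 1) '' {l | T l})

lemma single_mem_chainsOn {T : List V → Prop} {l : List V} (h : T l) :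
    Finsupp.single l 1 ∈ chainsOn K T :=
  Submodule.subset_span ⟨l, h, rfl⟩

lemma map_mem_of_chainsOn {M : Type*} [AddCommGroup M] [Module K M] {T : List V → Prop}
    (f : Chains K V →ₗ[K] M) (W : Submodule K M)
    (h : ∀ l, T l → f (Finsupp.single l 1) ∈ W) {z : Chains K V} (hz : z ∈ chainsOn K T) :
    f z ∈ W := by
  have : chainsOn K T ≤ W.comap f := by
    refine Submodule.span_le.2 ?_
    rintro _ ⟨l, hl, rfl⟩
    exact h l hl
  exact this hz

lemma chainsOn_mono {T T' : List V → Prop} (h : ∀ l, T l → T' l) {z : Chains K V}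
    (hz : z ∈ chainsOn K T) : z ∈ chainsOn K T' :=
  Submodule.span_mono (Set.image_mono h) hz

lemma eq_of_chainsOn {M : Type*} [AddCommGroup M] [Module K M] {T : List V → Prop}
    (f f' : Chains K V →ₗ[K] M)
    (h : ∀ l, T l → f (Finsupp.single l 1) = f' (Finsupp.single l 1)) {z : Chains K V}
    (hz : z ∈ chainsOn K T) : f z = f' z := by
  have := map_mem_of_chainsOn (f - f') ⊥ (fun l hl => by simp [h l hl]) hz
  simpa [sub_eq_zero] using this

lemma bdList_mem (l : List V) :
    bdList K l ∈ chainsOn K (fun m => m.Sublist l ∧ m.length + 1 = l.length) := by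
  induction l with
  | nil => simp [bdList]
  | cons a l ih =>
    refine Submodule.sub_mem _ (single_mem_chainsOn ⟨List.sublist_cons_self a l, rfl⟩) ?_
    refine map_mem_of_chainsOn _ _ ?_ ih
    rintro m ⟨h1, h2⟩
    rw [cone_single]
    exact single_mem_chainsOn ⟨h1.cons_cons a, by simp [h2]⟩

/-- The degenerate chains: combinations of lists with two equal consecutive vertices. -/
noncomputable def degen (K V : Type*) [CommRing K] : Submodule K (Chains K V) :=
  chainsOn K (fun l => ∃ u a v, l = u ++ a :: a :: v)

lemma cone_mem_degen (a : V) {z : Chains K V} (hz : z ∈ degen K V) : cone a z ∈ degen K V := by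
  refine map_mem_of_chainsOn _ _ ?_ hz
  rintro _ ⟨u, b, v, rfl⟩
  rw [cone_single]
  exact single_mem_chainsOn ⟨a :: u, b, v, rfl⟩

lemma cone_cone_mem_degen (a : V) (z : Chains K V) : cone a (cone a z) ∈ degen K V := by
  induction z using Finsupp.induction_linear with
  | zero => simp
  | add x y hx hy => simpa using Submodule.add_mem _ hx hy
  | single l x =>
    have := Submodule.smul_mem (degen K V) x (single_mem_chainsOn (K := K)
      (l := a :: a :: l) (T := fun l => ∃ u a v, l = u ++ a :: a :: v) ⟨[], a, l, rfl⟩)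
    simpa using this

lemma push_mem_degen (s : V → V) {z : Chains K V} (hz : z ∈ degen K V) :
    push s z ∈ degen K V := by
  refine map_mem_of_chainsOn _ _ ?_ hz
  rintro _ ⟨u, b, v, rfl⟩
  rw [push_single]
  exact single_mem_chainsOn ⟨u.map s, s b, v.map s, by simp⟩

lemma bd_mem_degen {z : Chains K V} (hz : z ∈ degen K V) : bd z ∈ degen K V := by
  refine map_mem_of_chainsOn _ _ ?_ hz
  rintro _ ⟨u, b, v, rfl⟩
  rw [bd_single, one_smul]
  induction u with
  | nil => simpa [bdList] using cone_cone_mem_degen b (bdList K v)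
  | cons a u ih =>
    exact Submodule.sub_mem _ (single_mem_chainsOn ⟨u, b, v, rfl⟩) (cone_mem_degen a ih)

/-- Normalized chains. -/
def NChains (K V : Type*) [CommRing K] := Chains K V ⧸ degen K V

noncomputable instance : AddCommGroup (NChains K V) :=
  inferInstanceAs (AddCommGroup (Chains K V ⧸ degen K V))

noncomputable instance : Module K (NChains K V) :=
  inferInstanceAs (Module K (Chains K V ⧸ degen K V))

/-- The class of a chain. -/
noncomputable def nmk : Chains K V →ₗ[K] NChains K V := (degen K V).mkQ

lemma nmk_surjective : Function.Surjective (nmk : Chains K V →ₗ[K] NChains K V) :=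
  (degen K V).mkQ_surjective

lemma nmk_eq_zero {z : Chains K V} (hz : z ∈ degen K V) : nmk z = 0 :=
  (Submodule.Quotient.mk_eq_zero _).2 hz

/-- The operator on normalized chains induced by an operator preserving degenerate chains. -/
noncomputable def nmap (f : Chains K V →ₗ[K] Chains K V)
    (hf : ∀ z ∈ degen K V, f z ∈ degen K V) : NChains K V →ₗ[K] NChains K V :=
  (degen K V).mapQ (degen K V) f hf

@[simp] lemma nmap_nmk (f : Chains K V →ₗ[K] Chains K V)
    (hf : ∀ z ∈ degen K V, f z ∈ degen K V) (z : Chains K V) : nmap f hf (nmk z) = nmk (f z) :=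
  rfl

lemma nchains_hom_ext {M : Type*} [AddCommGroup M] [Module K M] {f f' : NChains K V →ₗ[K] M}
    (h : ∀ l, f (nmk (Finsupp.single l 1)) = f' (nmk (Finsupp.single l 1))) : f = f' := by
  have h1 : f ∘ₗ nmk = f' ∘ₗ nmk := by
    ext l : 2
    simpa using h l
  ext x
  obtain ⟨z, rfl⟩ := nmk_surjective x
  exact LinearMap.congr_fun h1 z

/-- The cone operator on normalized chains. -/
noncomputable def ncone (a : V) : NChains K V →ₗ[K] NChains K V :=
  nmap (cone a) fun _ => cone_mem_degen a

/-- The boundary of normalized chains. -/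
noncomputable def nbd : NChains K V →ₗ[K] NChains K V :=
  nmap bd fun _ => bd_mem_degen

/-- The operator on normalized chains induced by a map of vertices. -/
noncomputable def npush (s : V → V) : NChains K V →ₗ[K] NChains K V :=
  nmap (push s) fun _ => push_mem_degen s

lemma nbd_ncone (a : V) (z : NChains K V) : nbd (ncone a z) = z - ncone a (nbd z) := by
  obtain ⟨z, rfl⟩ := nmk_surjective z
  simp [nbd, ncone, bd_cone]

lemma nbd_nbd (z : NChains K V) : nbd (nbd z) = 0 := by
  obtain ⟨z, rfl⟩ := nmk_surjective z
  simp [nbd, bd_bd]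

lemma npush_ncone (s : V → V) (a : V) (z : NChains K V) :
    npush s (ncone a z) = ncone (s a) (npush s z) := by
  obtain ⟨z, rfl⟩ := nmk_surjective z
  simp [npush, ncone, push_cone]

lemma npush_nbd (s : V → V) (z : NChains K V) : npush s (nbd z) = nbd (npush s z) := by
  obtain ⟨z, rfl⟩ := nmk_surjective z
  simp [npush, nbd, push_bd]

/-- The coefficient of the empty list. -/
noncomputable def augCoeff : NChains K V →ₗ[K] K :=
  (degen K V).liftQ (Finsupp.lapply []) (by
    intro z hz
    refine map_mem_of_chainsOn (Finsupp.lapply []) ⊥ ?_ hz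
    rintro _ ⟨u, b, v, rfl⟩
    simp)

lemma augCoeff_nmk (z : Chains K V) : augCoeff (nmk z) = z [] := rfl

/-- The class of the empty list. -/
noncomputable def nnil : NChains K V := nmk (Finsupp.single [] 1)

end Chains

section Descent

variable {K M : Type*} [CommRing K] [AddCommGroup M] [Module K M]

/-- The operators `1 + g + ⋯ + g ^ (p - 1)` (even index) and `1 - g` (odd index). -/
def rho (p : ℕ) (g : Module.End K M) (i : ℕ) : Module.End K M :=
  if Even i then ∑ k ∈ range p, g ^ k else 1 - g

lemma geom_mul_one_sub {p : ℕ} {g : Module.End K M} (hg : g ^ p = 1) :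
    (∑ k ∈ range p, g ^ k) * (1 - g) = 0 := by
  rw [geom_sum_mul_neg, hg, sub_self]

lemma one_sub_mul_geom {p : ℕ} {g : Module.End K M} (hg : g ^ p = 1) :
    (1 - g) * (∑ k ∈ range p, g ^ k) = 0 := by
  rw [mul_neg_geom_sum, hg, sub_self]

lemma rho_succ_mul_rho {p : ℕ} {g : Module.End K M} (hg : g ^ p = 1) (i : ℕ) :
    rho p g (i + 1) * rho p g i = 0 := by
  unfold rho
  by_cases h : Even i
  · simp [h, Nat.even_add_one, one_sub_mul_geom hg]
  · simp [h, Nat.even_add_one, geom_mul_one_sub hg]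

lemma rho_comm {p : ℕ} {g d : Module.End K M} (h : Commute d g) (i : ℕ) :
    Commute d (rho p g i) := by
  unfold rho
  split_ifs
  · exact Commute.sum_right _ _ _ fun k _ => h.pow_right k
  · exact (Commute.one_right d).sub_right h

lemma rho_comm_apply {p : ℕ} {g d : Module.End K M} (h : Commute d g) (i : ℕ) (x : M) :
    d (rho p g i x) = rho p g i (d x) :=
  LinearMap.congr_fun (rho_comm h i) x

lemma exists_of_rho_succ_eq_zero {p : ℕ} {g e : Module.End K M} (i : ℕ) {x : M}
    (hx : rho p g (i + 1) x = 0) :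
    ∃ b, (∑ k ∈ range p, g ^ k * e * g ^ (p - k)) x = rho p g i b := by
  by_cases h : Even i
  · have h1 : g x = x := by
      simp only [rho, Nat.even_add_one, h, not_true, if_false, LinearMap.sub_apply,
        Module.End.one_apply, sub_eq_zero] at hx
      exact hx.symm
    have h2 : ∀ k, (g ^ k) x = x := by
      intro k
      induction k with
      | zero => simp
      | succ k ih => rw [pow_succ, Module.End.mul_apply, h1, ih]
    refine ⟨e x, ?_⟩
    simp [rho, h, LinearMap.sum_apply, h2]
  · have h1 : (∑ k ∈ range p, g ^ k) x = 0 := by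
      simpa [rho, Nat.even_add_one, h] using hx
    have h2 : ∑ k ∈ range p, e ((g ^ (p - k)) x) = 0 := by
      rw [← map_sum]
      have : ∑ k ∈ range p, (g ^ (p - k)) x = g (∑ k ∈ range p, (g ^ k) x) := by
        rw [← Finset.sum_range_reflect, map_sum]
        refine Finset.sum_congr rfl fun k hk => ?_
        have hk := Finset.mem_range.1 hk
        rw [← Module.End.mul_apply, ← pow_succ']
        congr 2
        omega
      rw [this, ← LinearMap.sum_apply, h1, map_zero, map_zero]
    refine ⟨-∑ k ∈ range p, (∑ j ∈ range k, g ^ j) (e ((g ^ (p - k)) x)), ?_⟩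
    have h3 : ∀ k y, (1 - g) ((∑ j ∈ range k, g ^ j) y) = y - (g ^ k) y := by
      intro k y
      rw [← Module.End.mul_apply, mul_neg_geom_sum]
      simp
    simp only [rho, h, if_false, map_neg, map_sum, h3, Finset.sum_sub_distrib, h2]
    simp [LinearMap.sum_apply]

/-- A free `ℤ/p`-complex cannot carry a vanishing sequence of fundamental chains. -/
lemma descent {p : ℕ} [CharP K p] [Nontrivial K] {g d e : Module.End K M}
    (hd : ∀ x, d (d x) = 0) (hdg : Commute d g) (η : M →ₗ[K] K) (u : M)
    (hE : ∀ x, (∑ k ∈ range p, g ^ k * e * g ^ (p - k)) x = x - η x • u)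
    (hdu : d u = 0) (hηu : η u = 1) (hηg : ∀ x, η (g x) = η x) {D : ℕ} (y : ℕ → M)
    (hy : ∀ i, i ≤ D → η (y i) = 0) (hy0 : d (y 0) = u)
    (hyd : ∀ i, i < D → d (y (i + 1)) = rho p g (i + 1) (y i)) : y D ≠ 0 := by
  intro hD
  have key : ∀ j, j ≤ D → ∃ b b', y (D - j) = d b - η (d b) • u + rho p g (D - j) b' := by
    intro j
    induction j with
    | zero => exact fun _ => ⟨0, 0, by simp [hD]⟩
    | succ j ih =>
      intro hj
      obtain ⟨b, b', h⟩ := ih (by omega)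
      obtain ⟨i, hi⟩ : ∃ i, D - (j + 1) = i := ⟨_, rfl⟩
      have hi' : D - j = i + 1 := by omega
      rw [hi'] at h
      rw [hi]
      have h1 := hyd i (by omega)
      rw [h, map_add, map_sub, hd, map_smul, hdu, smul_zero, sub_zero, zero_add] at h1
      have h2 : d (rho p g (i + 1) b') = rho p g (i + 1) (d b') :=
        rho_comm_apply hdg (i + 1) b'
      rw [h2] at h1
      have h3 : rho p g (i + 1) (y i - d b') = 0 := by rw [map_sub, h1, sub_self]
      obtain ⟨c, hc⟩ := exists_of_rho_succ_eq_zero (e := e) i h3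
      rw [hE, map_sub, hy i (by omega)] at hc
      refine ⟨b', c, ?_⟩
      rw [← hc]
      module
  obtain ⟨b, b', h⟩ := key D le_rfl
  rw [Nat.sub_self] at h
  have h1 := hy0
  rw [h, map_add, map_sub, hd, map_smul, hdu, smul_zero, sub_zero, zero_add] at h1
  have h2 : d (rho p g 0 b') = rho p g 0 (d b') := rho_comm_apply hdg 0 b'
  have h3 : ∀ k x, η ((g ^ k) x) = η x := by
    intro k x
    induction k with
    | zero => simp
    | succ k ih => rw [pow_succ', Module.End.mul_apply, hηg, ih]
  rw [h2] at h1
  have h4 := congrArg η h1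
  rw [hηu] at h4
  simp [rho, LinearMap.sum_apply, h3] at h4

end Descent

section Tucker

variable {p : ℕ}

/-- The generator of the `ℤ/p`-action on signed indices. -/
def rot (p : ℕ) (a : ℕ × ZMod p) : ℕ × ZMod p := (a.1, a.2 + 1)

lemma iterate_rot (k : ℕ) (a : ℕ × ZMod p) : (rot p)^[k] a = (a.1, a.2 + k) := by
  induction k with
  | zero => simp
  | succ k ih => rw [Function.iterate_succ_apply', ih]; simp [rot, add_assoc]

variable {K : Type*} [CommRing K]

lemma npush_pow_mk (k : ℕ) (l : List (ℕ × ZMod p)) :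
    ((npush (rot p) : Module.End K (NChains K (ℕ × ZMod p))) ^ k)
      (nmk (Finsupp.single l 1)) =
      nmk (Finsupp.single (l.map (rot p)^[k]) 1) := by
  induction k with
  | zero => simp
  | succ k ih =>
    rw [pow_succ', Module.End.mul_apply, ih]
    rw [npush, nmap_nmk, push_single, List.map_map, Function.iterate_succ']

lemma npush_pow_eq_one :
    (npush (rot p) : Module.End K (NChains K (ℕ × ZMod p))) ^ p = 1 := by
  refine nchains_hom_ext fun l => ?_
  rw [npush_pow_mk]
  have : (rot p)^[p] = id := by
    funext a
    simp [iterate_rot]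
  simp [this]

/-- Projection to the lists whose first sign is `0`. -/
noncomputable def headZero : Chains K (ℕ × ZMod p) →ₗ[K] Chains K (ℕ × ZMod p) :=
  Finsupp.linearCombination K
    (fun l => if ∃ a ∈ l.head?, a.2 = 0 then Finsupp.single l 1 else 0)

lemma headZero_single (l : List (ℕ × ZMod p)) :
    headZero (Finsupp.single l (1 : K)) =
      if ∃ a ∈ l.head?, a.2 = 0 then Finsupp.single l 1 else 0 := by
  simp [headZero, Finsupp.linearCombination_single]

lemma headZero_mem_degen {z : Chains K (ℕ × ZMod p)} (hz : z ∈ degen K _) :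
    headZero z ∈ degen K _ := by
  refine map_mem_of_chainsOn _ _ ?_ hz
  intro l hl
  rw [headZero_single]
  split_ifs
  · exact single_mem_chainsOn hl
  · exact zero_mem _

/-- The projection `headZero` on normalized chains. -/
noncomputable def nheadZero : Module.End K (NChains K (ℕ × ZMod p)) :=
  nmap headZero fun _ => headZero_mem_degen

lemma nheadZero_mk (l : List (ℕ × ZMod p)) :
    nheadZero (nmk (Finsupp.single l (1 : K))) =
      if ∃ a ∈ l.head?, a.2 = 0 then nmk (Finsupp.single l 1) else 0 := by
  rw [nheadZero, nmap_nmk, headZero_single]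
  split_ifs <;> simp

lemma augCoeff_mk (l : List (ℕ × ZMod p)) :
    augCoeff (nmk (Finsupp.single l (1 : K))) = if l = [] then 1 else 0 := by
  rw [augCoeff_nmk, Finsupp.single_apply]

lemma sum_headZero [NeZero p] (x : NChains K (ℕ × ZMod p)) :
    (∑ k ∈ range p, (npush (rot p) : Module.End K (NChains K (ℕ × ZMod p))) ^ k * nheadZero *
      (npush (rot p) : Module.End K (NChains K (ℕ × ZMod p))) ^ (p - k) :
        Module.End K (NChains K (ℕ × ZMod p))) x =
      x - augCoeff x • (nnil : NChains K (ℕ × ZMod p)) := by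
  suffices h : (∑ k ∈ range p,
      (npush (rot p) : Module.End K (NChains K (ℕ × ZMod p))) ^ k * nheadZero *
      (npush (rot p) : Module.End K (NChains K (ℕ × ZMod p))) ^ (p - k) :
        Module.End K (NChains K (ℕ × ZMod p))) =
      (1 : Module.End K (NChains K (ℕ × ZMod p))) - augCoeff.smulRight nnil by
    rw [h]
    simp
  refine nchains_hom_ext fun l => ?_
  simp only [LinearMap.sum_apply, Module.End.mul_apply, npush_pow_mk, nheadZero_mk,
    LinearMap.sub_apply, LinearMap.smulRight_apply, augCoeff_mk, Module.End.one_apply]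
  cases l with
  | nil => simp [nnil]
  | cons a l =>
    have h1 : ∀ k ∈ range p,
        (∃ b ∈ ((a :: l).map (rot p)^[p - k]).head?, b.2 = 0) ↔ k = a.2.val := by
      intro k hk
      have hk := Finset.mem_range.1 hk
      simp only [List.map_cons, List.head?_cons, Option.mem_def, Option.some.injEq,
        exists_eq_left', iterate_rot, Nat.cast_sub hk.le, CharP.cast_eq_zero, zero_sub]
      rw [← sub_eq_add_neg, sub_eq_zero]
      constructor
      · intro h
        rw [h, ZMod.val_natCast, Nat.mod_eq_of_lt hk]
      · rintro rfl
        simp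
    rw [Finset.sum_eq_single_of_mem a.2.val (Finset.mem_range.2 (ZMod.val_lt _))]
    · rw [if_pos ((h1 _ (Finset.mem_range.2 (ZMod.val_lt _))).2 rfl), ← npush_pow_mk,
        ← Module.End.mul_apply, ← pow_add, Nat.add_sub_cancel' (ZMod.val_lt a.2).le,
        npush_pow_eq_one]
      simp
    · intro k hk hne
      rw [if_neg (fun h => hne ((h1 k hk).1 h)), map_zero]

/-- The faces of the `N`-fold join of `ℤ/p`. -/
def IsFace (p N : ℕ) (S : Finset (ℕ × ZMod p)) : Prop :=
  (∀ a ∈ S, ∀ b ∈ S, a.1 = b.1 → a = b) ∧ ∀ a ∈ S, a.1 < N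

lemma IsFace.mono {N : ℕ} {S T : Finset (ℕ × ZMod p)} (hT : IsFace p N T) (h : S ⊆ T) :
    IsFace p N S :=
  ⟨fun a ha b hb => hT.1 a (h ha) b (h hb), fun a ha => hT.2 a (h ha)⟩

variable (lam : Finset (ℕ × ZMod p) → ℕ × ZMod p)

/-- The values on lists of length `n` of the chain map induced by a labelling of faces, given by
the barycentric subdivision. -/
noncomputable def labelChain (K : Type*) [CommRing K] :
    ℕ → List (ℕ × ZMod p) → NChains K (ℕ × ZMod p)
  | 0, _ => nnil
  | n + 1, l =>
    ncone (lam l.toFinset) (Finsupp.linearCombination K (labelChain K n) (bdList K l))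

/-- The chain map induced by a labelling, on chains of `n` vertices. -/
noncomputable def labelMap (K : Type*) [CommRing K] (n : ℕ) :
    Chains K (ℕ × ZMod p) →ₗ[K] NChains K (ℕ × ZMod p) :=
  Finsupp.linearCombination K (labelChain lam K n)

lemma labelMap_single_succ (n : ℕ) (l : List (ℕ × ZMod p)) :
    labelMap lam K (n + 1) (Finsupp.single l 1) =
      ncone (lam l.toFinset) (labelMap lam K n (bdList K l)) := by
  simp [labelMap, Finsupp.linearCombination_single, labelChain]

lemma labelMap_zero_single (l : List (ℕ × ZMod p)) :
    labelMap lam K 0 (Finsupp.single l 1) = nnil := by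
  simp [labelMap, Finsupp.linearCombination_single, labelChain]

lemma nbd_nnil : nbd (nnil : NChains K (ℕ × ZMod p)) = 0 := by
  simp [nbd, nnil, bdList]

lemma npush_nnil (s : ℕ × ZMod p → ℕ × ZMod p) :
    npush s (nnil : NChains K (ℕ × ZMod p)) = nnil := by
  simp [npush, nnil]

lemma nbd_labelMap (n : ℕ) {z : Chains K (ℕ × ZMod p)}
    (hz : z ∈ chainsOn K (fun l => l.length = n + 1)) :
    nbd (labelMap lam K (n + 1) z) = labelMap lam K n (bd z) := by
  induction n generalizing z with
  | zero =>
    refine eq_of_chainsOn (nbd ∘ₗ labelMap lam K 1) (labelMap lam K 0 ∘ₗ bd) ?_ hz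
    intro l hl
    obtain ⟨a, rfl⟩ := List.length_eq_one_iff.1 (by simpa using hl)
    simp [labelMap_single_succ, bdList, labelMap_zero_single, nbd_ncone, nbd_nnil]
  | succ n ih =>
    refine eq_of_chainsOn (nbd ∘ₗ labelMap lam K (n + 1 + 1)) (labelMap lam K (n + 1) ∘ₗ bd) ?_ hz
    intro l hl
    have h : bdList K l ∈ chainsOn K (fun m => m.length = n + 1) := by
      refine chainsOn_mono (fun m hm => ?_) (bdList_mem l)
      omega
    simp [labelMap_single_succ, nbd_ncone, ih h, bd_bdList]

lemma npush_labelMap {N : ℕ}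
    (hlam : ∀ S, S.Nonempty → IsFace p N S → lam (S.image (rot p)) = rot p (lam S)) (n : ℕ)
    {z : Chains K (ℕ × ZMod p)}
    (hz : z ∈ chainsOn K (fun l => l.length = n ∧ IsFace p N l.toFinset)) :
    labelMap lam K n (push (rot p) z) = npush (rot p) (labelMap lam K n z) := by
  induction n generalizing z with
  | zero =>
    refine eq_of_chainsOn (labelMap lam K 0 ∘ₗ push (rot p))
      (npush (rot p) ∘ₗ labelMap lam K 0) ?_ hz
    intro l hl
    simp [labelMap_zero_single, npush_nnil]
  | succ n ih =>
    refine eq_of_chainsOn (labelMap lam K (n + 1) ∘ₗ push (rot p))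
      (npush (rot p) ∘ₗ labelMap lam K (n + 1)) ?_ hz
    rintro l ⟨hl, hf⟩
    have h : bdList K l ∈ chainsOn K (fun m => m.length = n ∧ IsFace p N m.toFinset) := by
      refine chainsOn_mono (fun m hm => ⟨?_, ?_⟩) (bdList_mem l)
      · omega
      · refine hf.mono fun a ha => ?_
        rw [List.mem_toFinset] at ha ⊢
        exact hm.1.subset ha
    have h1 : (l.map (rot p)).toFinset = l.toFinset.image (rot p) := by
      ext; simp
    have h2 : l.toFinset.Nonempty := by
      rw [List.toFinset_nonempty_iff]
      rintro rfl
      simp at hl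
    simp [labelMap_single_succ, h1, hlam _ h2 hf, ← push_bdList, ih h, npush_ncone]

lemma length_le_of_isChain (a : ℕ × ZMod p) (m : List (ℕ × ZMod p))
    (h : (a :: m).IsChain (fun x y => y.1 < x.1)) : m.length ≤ a.1 := by
  induction m generalizing a with
  | nil => simp
  | cons b m ih =>
    rw [List.isChain_cons_cons] at h
    have := ih b h.2
    simp only [List.length_cons]
    omega

/-- Classes of lists of length `n + 1` starting with `a` whose indices decrease strictly. -/
noncomputable def decreasing (K : Type*) [CommRing K] (n : ℕ) (a : ℕ × ZMod p) :
    Submodule K (NChains K (ℕ × ZMod p)) :=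
  Submodule.span K ((fun m => nmk (Finsupp.single (a :: m) 1)) ''
    {m | m.length = n ∧ (a :: m).IsChain (fun x y => y.1 < x.1)})

lemma labelMap_mem_decreasing {N : ℕ}
    (hmono : ∀ S T, S.Nonempty → S ⊆ T → IsFace p N T →
      lam S = lam T ∨ (lam S).1 < (lam T).1) (n : ℕ) {l : List (ℕ × ZMod p)}
    (hl : l.length = n + 1) (hf : IsFace p N l.toFinset) :
    labelMap lam K (n + 1) (Finsupp.single l 1) ∈ decreasing K n (lam l.toFinset) := by
  induction n generalizing l with
  | zero =>
    obtain ⟨a, rfl⟩ := List.length_eq_one_iff.1 (by simpa using hl)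
    rw [labelMap_single_succ]
    refine Submodule.subset_span ⟨[], by simp, ?_⟩
    simp [bdList, labelMap_zero_single, ncone, nnil]
  | succ n ih =>
    rw [labelMap_single_succ]
    refine map_mem_of_chainsOn (ncone (lam l.toFinset) ∘ₗ labelMap lam K (n + 1)) _ ?_
      (bdList_mem l)
    rintro m ⟨hm, hml⟩
    have hsub : m.toFinset ⊆ l.toFinset := fun a ha => by
      rw [List.mem_toFinset] at ha ⊢
      exact hm.subset ha
    have hne : m.toFinset.Nonempty := by
      rw [List.toFinset_nonempty_iff]
      rintro rfl
      simp at hml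
      omega
    have h1 := ih (l := m) (by omega) (hf.mono hsub)
    have h2 : decreasing K n (lam m.toFinset) ≤
        (decreasing K (n + 1) (lam l.toFinset)).comap (ncone (lam l.toFinset)) := by
      refine Submodule.span_le.2 ?_
      rintro _ ⟨v, ⟨hv, hc⟩, rfl⟩
      rw [SetLike.mem_coe, Submodule.mem_comap]
      have h3 : ncone (lam l.toFinset)
          (nmk (Finsupp.single (lam m.toFinset :: v) (1 : K))) =
          nmk
            (Finsupp.single (lam l.toFinset :: lam m.toFinset :: v) (1 : K)) := by
        simp [ncone]
      rw [h3]
      rcases hmono _ _ hne hsub hf with h | h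
      · rw [h, nmk_eq_zero]
        · exact zero_mem _
        · exact single_mem_chainsOn ⟨[], _, v, rfl⟩
      · exact Submodule.subset_span ⟨lam m.toFinset :: v, ⟨by simp [hv],
          List.isChain_cons_cons.2 ⟨h, hc⟩⟩, rfl⟩
    exact h2 h1

/-- The fundamental chains of the iterated join of `ℤ/p`. -/
noncomputable def fund (p : ℕ) (K : Type*) [CommRing K] : ℕ → Chains K (ℕ × ZMod p)
  | 0 => Finsupp.single [(0, 0)] 1
  | i + 1 => cone (i + 1, 0) (rho p (push (rot p)) (i + 1) (fund p K i))

lemma rho_mem {M : Type*} [AddCommGroup M] [Module K M] {g : Module.End K M}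
    {W : Submodule K M} (h : ∀ x ∈ W, g x ∈ W) (i : ℕ) {x : M} (hx : x ∈ W) :
    rho p g i x ∈ W := by
  have hk : ∀ k, (g ^ k) x ∈ W := by
    intro k
    induction k with
    | zero => simpa
    | succ k ih => rw [pow_succ', Module.End.mul_apply]; exact h _ ih
  unfold rho
  split_ifs
  · rw [LinearMap.sum_apply]
    exact Submodule.sum_mem _ fun k _ => hk k
  · exact Submodule.sub_mem _ hx (h _ hx)

lemma push_rot_mem (i : ℕ) {z : Chains K (ℕ × ZMod p)}
    (hz : z ∈ chainsOn K (fun l => l.map Prod.fst = (List.range (i + 1)).reverse)) :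
    push (rot p) z ∈ chainsOn K (fun l => l.map Prod.fst = (List.range (i + 1)).reverse) := by
  refine map_mem_of_chainsOn _ _ (fun l hl => ?_) hz
  rw [push_single]
  refine single_mem_chainsOn ?_
  rw [← hl, List.map_map]
  rfl

lemma fund_mem (i : ℕ) :
    fund p K i ∈ chainsOn K (fun l => l.map Prod.fst = (List.range (i + 1)).reverse) := by
  induction i with
  | zero => exact single_mem_chainsOn (by simp)
  | succ i ih =>
    refine map_mem_of_chainsOn _ _ (fun l hl => ?_)
      (rho_mem (p := p) (fun _ => push_rot_mem i) (i + 1) ih)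
    rw [cone_single]
    refine single_mem_chainsOn ?_
    rw [List.map_cons, hl, List.range_succ (n := i + 1), List.reverse_append]
    rfl

lemma push_rot_pow_eq_one : (push (rot p) : Module.End K (Chains K (ℕ × ZMod p))) ^ p = 1 := by
  have h : ∀ k (l : List (ℕ × ZMod p)),
      ((push (rot p) : Module.End K (Chains K (ℕ × ZMod p))) ^ k) (Finsupp.single l 1) =
        Finsupp.single (l.map (rot p)^[k]) 1 := by
    intro k l
    induction k with
    | zero => simp
    | succ k ih => rw [pow_succ', Module.End.mul_apply, ih, push_single, List.map_map,
      Function.iterate_succ']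
  have h2 : (rot p)^[p] = id := by
    funext a
    simp [iterate_rot]
  ext l : 2
  simp [h, h2]

lemma bd_fund (i : ℕ) : bd (fund p K (i + 1)) = rho p (push (rot p)) (i + 1) (fund p K i) := by
  have hc : Commute (bd : Module.End K (Chains K (ℕ × ZMod p))) (push (rot p)) :=
    LinearMap.ext fun z => (push_bd _ z).symm
  have hb : ∀ z, bd (rho p (push (rot p)) (i + 1) z) =
      rho p (push (rot p)) (i + 1) (bd z : Chains K (ℕ × ZMod p)) :=
    rho_comm_apply hc (i + 1)
  have h0 : rho p (push (rot p)) (i + 1) (bd (fund p K i)) = 0 := by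
    induction i with
    | zero => simp [fund, bdList, rho]
    | succ i ih =>
      have hb' : ∀ z, bd (rho p (push (rot p)) (i + 1) z) =
          rho p (push (rot p)) (i + 1) (bd z : Chains K (ℕ × ZMod p)) :=
        rho_comm_apply hc (i + 1)
      rw [fund, bd_cone, hb', ih hb', map_zero, sub_zero, ← Module.End.mul_apply,
        rho_succ_mul_rho push_rot_pow_eq_one]
      rfl
  rw [fund, bd_cone, hb, h0, map_zero, sub_zero]

/-- A `ℤ/p`-equivariant labelling of the faces of the `N`-fold join of `ℤ/p` by `D` signed labels
that is simplicial on the barycentric subdivision exists only if `N ≤ D`. -/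
theorem le_of_labelling [Fact p.Prime] {N D : ℕ}
    (hrot : ∀ S, S.Nonempty → IsFace p N S → lam (S.image (rot p)) = rot p (lam S))
    (hmono : ∀ S T, S.Nonempty → S ⊆ T → IsFace p N T →
      lam S = lam T ∨ (lam S).1 < (lam T).1)
    (hD : ∀ S, S.Nonempty → IsFace p N S → (lam S).1 < D) : N ≤ D := by
  by_contra! hlt
  have hgood : ∀ i (l : List (ℕ × ZMod p)), i < N → l.map Prod.fst = (List.range (i + 1)).reverse →
      l.length = i + 1 ∧ IsFace p N (l.toFinset : Finset (ℕ × ZMod p)) := by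
    intro i l hi hl
    refine ⟨by simpa using congrArg List.length hl, ?_, ?_⟩
    · intro a ha b hb hab
      rw [List.mem_toFinset] at ha hb
      refine List.inj_on_of_nodup_map ?_ ha hb hab
      rw [hl, List.nodup_reverse]
      exact List.nodup_range
    · intro a ha
      rw [List.mem_toFinset] at ha
      have : a.1 ∈ l.map Prod.fst := List.mem_map_of_mem ha
      rw [hl, List.mem_reverse, List.mem_range] at this
      omega
  let y : ℕ → NChains (ZMod p) (ℕ × ZMod p) :=
    fun i => labelMap lam (ZMod p) (i + 1) (fund p (ZMod p) i)
  have hfm : ∀ i, i < N → fund p (ZMod p) i ∈ chainsOn (ZMod p)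
      (fun l => l.length = i + 1 ∧ IsFace p N (l.toFinset : Finset (ℕ × ZMod p))) := fun i hi =>
    chainsOn_mono (fun l hl => hgood i l hi hl) (fund_mem i)
  have hlen : ∀ i, i < N → fund p (ZMod p) i ∈ chainsOn (ZMod p)
      (fun l => l.length = i + 1) := fun i hi =>
    chainsOn_mono (fun l hl => hl.1) (hfm i hi)
  have hpushmem : ∀ i, ∀ z ∈ chainsOn (ZMod p)
      (fun l => l.length = i ∧ IsFace p N (l.toFinset : Finset (ℕ × ZMod p))),
      push (rot p) z ∈ chainsOn (ZMod p)
      (fun l => l.length = i ∧ IsFace p N (l.toFinset : Finset (ℕ × ZMod p))) := by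
    intro i z hz
    refine map_mem_of_chainsOn _ _ (fun l hl => ?_) hz
    rw [push_single]
    refine single_mem_chainsOn ⟨by simpa using hl.1, ?_, ?_⟩
    · intro a ha b hb hab
      simp only [List.mem_toFinset, List.mem_map] at ha hb
      obtain ⟨a, ha, rfl⟩ := ha
      obtain ⟨b, hb, rfl⟩ := hb
      rw [hl.2.1 a (List.mem_toFinset.2 ha) b (List.mem_toFinset.2 hb) hab]
    · intro a ha
      simp only [List.mem_toFinset, List.mem_map] at ha
      obtain ⟨a, ha, rfl⟩ := ha
      exact hl.2.2 a (List.mem_toFinset.2 ha)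
  have hpow : ∀ i k, ∀ z ∈ chainsOn (ZMod p)
      (fun l => l.length = i ∧ IsFace p N (l.toFinset : Finset (ℕ × ZMod p))),
      (push (rot p) ^ k : Module.End (ZMod p) _) z ∈ chainsOn (ZMod p)
        (fun l => l.length = i ∧ IsFace p N (l.toFinset : Finset (ℕ × ZMod p))) ∧
      labelMap lam (ZMod p) i ((push (rot p) ^ k : Module.End (ZMod p) _) z) =
        (npush (rot p) ^ k : Module.End (ZMod p) _) (labelMap lam (ZMod p) i z) := by
    intro i k z hz
    induction k with
    | zero => simpa
    | succ k ih =>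
      rw [pow_succ', pow_succ', Module.End.mul_apply, Module.End.mul_apply]
      exact ⟨hpushmem i _ ih.1, by rw [npush_labelMap lam hrot i ih.1, ih.2]⟩
  have hrho : ∀ i j, ∀ z ∈ chainsOn (ZMod p)
      (fun l => l.length = i ∧ IsFace p N (l.toFinset : Finset (ℕ × ZMod p))),
      labelMap lam (ZMod p) i (rho p (push (rot p)) j z) =
        rho p (npush (rot p)) j (labelMap lam (ZMod p) i z) := by
    intro i j z hz
    unfold rho
    split_ifs
    · rw [LinearMap.sum_apply, LinearMap.sum_apply, map_sum]
      exact Finset.sum_congr rfl fun k _ => (hpow i k z hz).2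
    · simp [npush_labelMap lam hrot i hz]
  refine descent (p := p) (g := npush (rot p)) (d := nbd) (e := nheadZero)
    nbd_nbd (LinearMap.ext fun z => (npush_nbd _ z).symm) augCoeff nnil sum_headZero nbd_nnil
    ?_ ?_ y (D := D) ?_ ?_ ?_ ?_
  · rw [nnil, augCoeff_mk, if_pos rfl]
  · intro x
    suffices h : augCoeff ∘ₗ npush (rot p) =
        (augCoeff : NChains (ZMod p) (ℕ × ZMod p) →ₗ[ZMod p] ZMod p) from
      LinearMap.congr_fun h x
    refine nchains_hom_ext fun l => ?_
    have := npush_pow_mk (K := ZMod p) 1 l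
    rw [pow_one] at this
    rw [LinearMap.comp_apply, this, augCoeff_mk, augCoeff_mk]
    simp
  · intro i hi
    have := map_mem_of_chainsOn (augCoeff ∘ₗ labelMap lam (ZMod p) (i + 1)) ⊥ ?_
      (hlen i (by omega))
    · simpa using this
    · intro l hl
      rw [LinearMap.comp_apply, labelMap_single_succ]
      have h : augCoeff ∘ₗ ncone (lam l.toFinset) =
          (0 : NChains (ZMod p) (ℕ × ZMod p) →ₗ[ZMod p] ZMod p) := by
        refine nchains_hom_ext fun m => ?_
        have : ncone (lam l.toFinset) (nmk (Finsupp.single m (1 : ZMod p))) =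
            nmk (Finsupp.single (lam l.toFinset :: m) (1 : ZMod p)) := by
          simp [ncone]
        rw [LinearMap.comp_apply, this, augCoeff_mk]
        simp
      simpa using LinearMap.congr_fun h _
  · change nbd (labelMap lam (ZMod p) 1 (fund p (ZMod p) 0)) = nnil
    rw [nbd_labelMap lam 0 (hlen 0 (by omega))]
    simp [fund, bdList, labelMap_zero_single]
  · intro i hi
    change nbd (labelMap lam (ZMod p) (i + 1 + 1) (fund p (ZMod p) (i + 1))) = _
    rw [nbd_labelMap lam (i + 1) (hlen (i + 1) (by omega)), bd_fund,
      hrho (i + 1) (i + 1) _ (hfm i (by omega))]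
  · have := map_mem_of_chainsOn (labelMap lam (ZMod p) (D + 1)) ⊥ ?_ (hfm D hlt)
    · simpa using this
    · rintro l ⟨hl, hf⟩
      have hne : l.toFinset.Nonempty := by
        rw [List.toFinset_nonempty_iff]
        rintro rfl
        simp at hl
      have h1 := labelMap_mem_decreasing (K := ZMod p) lam hmono D hl hf
      have h2 : decreasing (ZMod p) D (lam l.toFinset) ≤ ⊥ := by
        refine Submodule.span_le.2 ?_
        rintro _ ⟨m, ⟨hm, hc⟩, rfl⟩
        have := length_le_of_isChain _ _ hc
        have := hD _ hne hf
        omega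
      exact h2 h1

end Tucker

section Sign

variable {p : ℕ}

lemma const_of_periodic [Fact p.Prime] {β : Type*} {q : ZMod p → β} {d : ZMod p} (hd : d ≠ 0)
    (h : ∀ x, q (x + d) = q x) (x y : ZMod p) : q x = q y := by
  have h1 : ∀ m : ℕ, q (y + m * d) = q y := by
    intro m
    induction m with
    | zero => simp
    | succ m ih => rw [Nat.cast_succ, add_mul, one_mul, ← add_assoc, h, ih]
  have h2 := h1 ((x - y) / d).val
  rwa [ZMod.natCast_zmod_val, div_mul_cancel₀ _ hd, add_sub_cancel] at h2

/-- There is an equivariant map from the nonconstant functions on `ZMod p` to `ZMod p`. -/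
lemma exists_sign (p : ℕ) [Fact p.Prime] (β : Type*) :
    ∃ s : (ZMod p → β) → ZMod p, ∀ A : ZMod p → β, (∃ x y, A x ≠ A y) →
      s (fun x => A (x - 1)) = s A + 1 := by
  let S : Setoid (ZMod p → β) :=
    { r := fun A A' => ∃ d, ∀ x, A' x = A (x - d)
      iseqv :=
        { refl := fun A => ⟨0, fun x => by rw [sub_zero]⟩
          symm := fun {A A'} ⟨d, h⟩ =>
            ⟨-d, fun x => by rw [h, sub_neg_eq_add, add_sub_cancel_right]⟩
          trans := fun {A A' A''} ⟨d, h⟩ ⟨d', h'⟩ =>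
            ⟨d' + d, fun x => by rw [h', h, sub_sub]⟩ } }
  have h : ∀ A : ZMod p → β, ∃ d, ∀ x, A x = (Quotient.mk S A).out (x - d) := fun A =>
    Quotient.mk_out A
  choose s hs using h
  refine ⟨s, fun A ⟨x, y, hxy⟩ => ?_⟩
  by_contra hne
  have hq : Quotient.mk S (fun x => A (x - 1)) = Quotient.mk S A :=
    Quotient.sound (S.symm ⟨1, fun _ => rfl⟩)
  have h1 := hs (fun x => A (x - 1))
  rw [hq] at h1
  refine hxy ?_
  refine (hs A x).trans (Eq.trans ?_ (hs A y).symm)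
  refine const_of_periodic (sub_ne_zero.2 hne) (fun z => ?_) _ _
  have h2 := h1 (z + s fun x => A (x - 1))
  rw [add_sub_cancel_right] at h2
  rw [← h2, hs A]
  exact congrArg _ (by ring)

end Sign

section Labelling

variable {α : Type*} {p : ℕ} [NeZero p] (k : ℕ) (c : Finset α → ℕ)

/-- The largest colour of a `k`-subset of a member of the family. -/
def topColour (A : ZMod p → Finset α) : ℕ :=
  univ.sup fun x => (powersetCard k (A x)).sup c

/-- The indices of the members of the family having a `k`-subset of the largest colour. -/
def topIndices (A : ZMod p → Finset α) : Finset (ZMod p) :=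
  {x | ∃ B ∈ powersetCard k (A x), c B = topColour k c A}

/-- The rank of a family of sets in the labelling of faces. -/
def familyRank (A : ZMod p → Finset α) : ℕ :=
  if ∀ x, #(A x) < k then ∑ x, #(A x) - 1
  else p * (k - 1) + topColour k c A * (p - 1) + #(topIndices k c A) - 1

lemma mem_topIndices {A : ZMod p → Finset α} {x : ZMod p} :
    x ∈ topIndices k c A ↔ ∃ B ⊆ A x, #B = k ∧ c B = topColour k c A := by
  simp [topIndices, mem_powersetCard, and_assoc]

lemma le_topColour {A : ZMod p → Finset α} {x : ZMod p} {B : Finset α} (hB : B ⊆ A x)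
    (hk : #B = k) : c B ≤ topColour k c A :=
  (le_sup (f := c) (mem_powersetCard.2 ⟨hB, hk⟩)).trans
    (le_sup (f := fun x => (powersetCard k (A x)).sup c) (mem_univ x))

lemma topIndices_nonempty {A : ZMod p → Finset α} (h : ¬ ∀ x, #(A x) < k) :
    (topIndices k c A).Nonempty := by
  push Not at h
  obtain ⟨y, hy⟩ := h
  obtain ⟨x, -, hx⟩ := exists_mem_eq_sup (univ : Finset (ZMod p)) univ_nonempty
    fun x => (powersetCard k (A x)).sup c
  change topColour k c A = _ at hx
  by_cases hne : (powersetCard k (A x)).Nonempty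
  · obtain ⟨B, hB, h⟩ := exists_mem_eq_sup _ hne c
    exact ⟨x, by simpa [topIndices] using ⟨B, mem_powersetCard.1 hB, (hx.trans h).symm⟩⟩
  · rw [not_nonempty_iff_eq_empty] at hne
    rw [hne, sup_empty] at hx
    obtain ⟨B, hB, hBk⟩ := exists_subset_card_eq hy
    have h1 := le_topColour k c hB hBk
    rw [hx] at h1
    exact ⟨y, (mem_topIndices k c).2 ⟨B, hB, hBk, (Nat.le_zero.1 h1).trans hx.symm⟩⟩

lemma topColour_mono {A A' : ZMod p → Finset α} (h : ∀ x, A x ⊆ A' x) :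
    topColour k c A ≤ topColour k c A' :=
  sup_mono_fun fun x _ => sup_mono (powersetCard_mono (h x))

lemma topIndices_mono {A A' : ZMod p → Finset α} (h : ∀ x, A x ⊆ A' x)
    (he : topColour k c A = topColour k c A') : topIndices k c A ⊆ topIndices k c A' := by
  intro x
  rw [mem_topIndices, mem_topIndices, he]
  exact fun ⟨B, hB, h'⟩ => ⟨B, hB.trans (h x), h'⟩

lemma topColour_shift (A : ZMod p → Finset α) :
    topColour k c (fun x => A (x - 1)) = topColour k c A := by
  refine le_antisymm (Finset.sup_le fun x _ => ?_) (Finset.sup_le fun x _ => ?_)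
  · exact le_sup (f := fun x => (powersetCard k (A x)).sup c) (mem_univ (x - 1))
  · have := le_sup (f := fun x => (powersetCard k (A (x - 1))).sup c) (mem_univ (x + 1))
    rwa [add_sub_cancel_right] at this

lemma mem_topIndices_shift (A : ZMod p → Finset α) (x : ZMod p) :
    x ∈ topIndices k c (fun x => A (x - 1)) ↔ x - 1 ∈ topIndices k c A := by
  rw [mem_topIndices, mem_topIndices, topColour_shift]

lemma card_topIndices_shift (A : ZMod p → Finset α) :
    #(topIndices k c (fun x => A (x - 1))) = #(topIndices k c A) := by
  refine card_equiv (Equiv.subRight 1) fun x => ?_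
  rw [mem_topIndices_shift, Equiv.subRight_apply]

omit [NeZero p] in
lemma forall_card_lt_shift (A : ZMod p → Finset α) :
    (∀ x, #(A (x - 1)) < k) ↔ ∀ x, #(A x) < k :=
  (Equiv.subRight (1 : ZMod p)).forall_congr_left.trans (by simp)

lemma familyRank_shift (A : ZMod p → Finset α) :
    familyRank k c (fun x => A (x - 1)) = familyRank k c A := by
  rw [familyRank, familyRank, topColour_shift, card_topIndices_shift,
    ← (Equiv.subRight (1 : ZMod p)).sum_comp fun x => #(A x)]
  exact if_congr (forall_card_lt_shift k A) rfl rfl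

/-- The label of a family of sets, for given sign functions. -/
def familyLabel (s : (ZMod p → Finset α) → ZMod p) (s' : (ZMod p → Prop) → ZMod p)
    (A : ZMod p → Finset α) : ℕ × ZMod p :=
  (familyRank k c A,
    if ∀ x, #(A x) < k then s A else s' fun x => x ∈ topIndices k c A)

/-- The families under consideration: they have a member containing a vertex, no vertex is in all
the members, and some member has no `k`-subset of the largest colour. -/
structure IsAdmissible (t : ℕ) (A : ZMod p → Finset α) : Prop where
  nonempty : ∃ x, (A x).Nonempty
  exists_notMem : ∀ v, ∃ x, v ∉ A x
  colour_lt : ∀ x, ∀ B ⊆ A x, #B = k → c B < t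
  exists_notMem_topIndices : ∃ x, x ∉ topIndices k c A

variable {k c}

lemma IsAdmissible.card_pos {t : ℕ} {A : ZMod p → Finset α} (h : IsAdmissible k c t A) :
    0 < ∑ x, #(A x) := by
  obtain ⟨x, hx⟩ := h.nonempty
  exact hx.card_pos.trans_le (single_le_sum (f := fun x => #(A x)) (fun _ _ => Nat.zero_le _)
    (mem_univ x))

lemma sum_card_le {A : ZMod p → Finset α} (h : ∀ x, #(A x) < k) :
    ∑ x, #(A x) ≤ p * (k - 1) := by
  have := sum_le_card_nsmul univ (fun x => #(A x)) (k - 1) fun x _ => Nat.le_sub_one_of_lt (h x)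
  rwa [card_univ, ZMod.card, smul_eq_mul] at this

lemma IsAdmissible.card_topIndices_lt {t : ℕ} {A : ZMod p → Finset α}
    (h : IsAdmissible k c t A) : #(topIndices k c A) < p := by
  obtain ⟨x, hx⟩ := h.exists_notMem_topIndices
  have := card_lt_univ_of_notMem hx
  rwa [ZMod.card] at this

lemma IsAdmissible.topColour_lt {t : ℕ} {A : ZMod p → Finset α}
    (h : IsAdmissible k c t A) (hA : ¬ ∀ x, #(A x) < k) : topColour k c A < t := by
  obtain ⟨x, hx⟩ := topIndices_nonempty k c hA
  obtain ⟨B, hB, hk, he⟩ := (mem_topIndices k c).1 hx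
  exact he ▸ h.colour_lt x B hB hk

lemma IsAdmissible.familyRank_lt {t : ℕ} {A : ZMod p → Finset α}
    (h : IsAdmissible k c t A) : familyRank k c A < p * (k - 1) + t * (p - 1) := by
  unfold familyRank
  split_ifs with hA
  · have := h.card_pos
    have := sum_card_le hA
    omega
  · have h1 := h.card_topIndices_lt
    have h2 := (topIndices_nonempty k c hA).card_pos
    have h3 : (topColour k c A + 1) * (p - 1) ≤ t * (p - 1) :=
      Nat.mul_le_mul_right _ (h.topColour_lt hA)
    rw [add_one_mul] at h3
    omega

lemma IsAdmissible.familyLabel_mono {t : ℕ} {A A' : ZMod p → Finset α}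
    (h : IsAdmissible k c t A) (hle : ∀ x, A x ⊆ A' x)
    (s : (ZMod p → Finset α) → ZMod p) (s' : (ZMod p → Prop) → ZMod p) :
    familyLabel k c s s' A = familyLabel k c s s' A' ∨
      (familyLabel k c s s' A).1 < (familyLabel k c s s' A').1 := by
  by_cases hA' : ∀ x, #(A' x) < k
  · have hA : ∀ x, #(A x) < k := fun x => (card_le_card (hle x)).trans_lt (hA' x)
    by_cases he : A = A'
    · rw [he]
      exact Or.inl rfl
    · obtain ⟨x, hx⟩ := Function.ne_iff.1 he
      have h1 : ∑ x, #(A x) < ∑ x, #(A' x) :=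
        sum_lt_sum (fun x _ => card_le_card (hle x))
          ⟨x, mem_univ x, card_lt_card ((hle x).ssubset_of_ne hx)⟩
      have := h.card_pos
      refine Or.inr ?_
      simp only [familyLabel, familyRank, if_pos hA, if_pos hA']
      omega
  · have hI' := (topIndices_nonempty k c hA').card_pos
    by_cases hA : ∀ x, #(A x) < k
    · have h1 := h.card_pos
      have h2 := sum_card_le hA
      refine Or.inr ?_
      simp only [familyLabel, familyRank, if_pos hA, if_neg hA']
      omega
    · have hI := (topIndices_nonempty k c hA).card_pos
      simp only [familyLabel, familyRank, if_neg hA, if_neg hA']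
      rcases (topColour_mono k c hle).lt_or_eq with hlt | heq
      · have h1 := h.card_topIndices_lt
        have h3 : (topColour k c A + 1) * (p - 1) ≤ topColour k c A' * (p - 1) :=
          Nat.mul_le_mul_right _ hlt
        rw [add_one_mul] at h3
        omega
      · have hsub := topIndices_mono k c hle heq
        rcases eq_or_ne (topIndices k c A) (topIndices k c A') with he | hne
        · exact Or.inl (by rw [he, heq])
        · have := card_lt_card (hsub.ssubset_of_ne hne)
          rw [heq]
          omega

lemma IsAdmissible.familyLabel_shift {t : ℕ} {A : ZMod p → Finset α}
    (h : IsAdmissible k c t A) {s : (ZMod p → Finset α) → ZMod p}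
    (hs : ∀ A, (∃ x y, A x ≠ A y) → s (fun x => A (x - 1)) = s A + 1)
    {s' : (ZMod p → Prop) → ZMod p}
    (hs' : ∀ A, (∃ x y, A x ≠ A y) → s' (fun x => A (x - 1)) = s' A + 1) :
    familyLabel k c s s' (fun x => A (x - 1)) = rot p (familyLabel k c s s' A) := by
  refine Prod.ext (familyRank_shift k c A) ?_
  by_cases hA : ∀ x, #(A x) < k
  · simp only [familyLabel, rot, forall_card_lt_shift, if_pos hA]
    obtain ⟨x, v, hv⟩ := h.nonempty
    obtain ⟨y, hy⟩ := h.exists_notMem v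
    exact hs A ⟨x, y, fun he => hy (he ▸ hv)⟩
  · simp only [familyLabel, rot, forall_card_lt_shift, if_neg hA, mem_topIndices_shift]
    obtain ⟨x, hx⟩ := topIndices_nonempty k c hA
    obtain ⟨y, hy⟩ := h.exists_notMem_topIndices
    exact hs' (fun x => x ∈ topIndices k c A) ⟨x, y, fun he => hy (he ▸ hx)⟩

end Labelling

section Prime

variable {α : Type*} [DecidableEq α]

/-- Every colouring with few colours of the `k`-subsets of `L ∪ R` has `r` sets of the same colour
such that every element of `L` is in at most one of them and no element of `R` is in all of them.
The parameter `g` is a surplus of colours compensated by additional elements of `L`. -/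
def HasMonoFamilies (α : Type*) [DecidableEq α] (r : ℕ) : Prop :=
  ∀ (L R : Finset α) (k t g : ℕ) (c : Finset α → ℕ), Disjoint L R → 1 ≤ k → t ≤ #R + g →
    r * k + (r - 1) * g ≤ #L + 1 → (∀ B ⊆ L ∪ R, #B = k → c B < t) →
    ∃ (B : Fin r → Finset α) (j : ℕ), (∀ i, B i ⊆ L ∪ R ∧ #(B i) = k ∧ c (B i) = j) ∧
      (∀ x ∈ L, ∀ i i', x ∈ B i → x ∈ B i' → i = i') ∧ ∀ x ∈ R, ∃ i, x ∉ B i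

omit [DecidableEq α] in
lemma exists_copies {L R : Finset α} (hLR : Disjoint L R) (q : ℕ) (h : 0 < #L + q * #R) :
    ∃ f : ℕ → α × ℕ, Set.InjOn f {i | i < #L + q * #R} ∧
      ∀ i < #L + q * #R, (f i).1 ∈ L ∧ (f i).2 = 0 ∨ (f i).1 ∈ R ∧ (f i).2 < q := by
  have hd : Disjoint (L ×ˢ range 1) (R ×ˢ range q) :=
    Finset.disjoint_product.2 (Or.inl hLR)
  have hcard : #((L ×ˢ range 1).disjUnion (R ×ˢ range q) hd) = #L + q * #R := by
    rw [card_disjUnion, card_product, card_product, card_range, card_range, mul_one, mul_comm]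
  set s := (L ×ˢ range 1).disjUnion (R ×ˢ range q) hd with hs
  have e := s.equivFinOfCardEq hcard
  refine ⟨fun i => if hi : i < #L + q * #R then (e.symm ⟨i, hi⟩).1 else (e.symm ⟨0, h⟩).1, ?_, ?_⟩
  · intro i (hi : i < _) j (hj : j < _) hij
    simp only [dif_pos hi, dif_pos hj] at hij
    simpa using e.symm.injective (Subtype.ext hij)
  · intro i hi
    have := (e.symm ⟨i, hi⟩).2
    simp only [dif_pos hi]
    generalize (e.symm ⟨i, hi⟩).1 = a at this ⊢
    rwa [hs, mem_disjUnion, mem_product, mem_product, mem_range, mem_range,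
      Nat.lt_one_iff] at this

/-- The sets of the elements with a given sign. -/
def signedSet {p : ℕ} (f : ℕ → α × ℕ) (S : Finset (ℕ × ZMod p)) (x : ZMod p) : Finset α :=
  {a ∈ S | a.2 = x}.image fun a => (f a.1).1

lemma mem_signedSet {p : ℕ} {f : ℕ → α × ℕ} {S : Finset (ℕ × ZMod p)} {x : ZMod p} {v : α} :
    v ∈ signedSet f S x ↔ ∃ i, (i, x) ∈ S ∧ (f i).1 = v := by
  simp [signedSet]

lemma signedSet_mono {p : ℕ} (f : ℕ → α × ℕ) {S T : Finset (ℕ × ZMod p)} (h : S ⊆ T)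
    (x : ZMod p) : signedSet f S x ⊆ signedSet f T x := by
  intro v
  rw [mem_signedSet, mem_signedSet]
  exact fun ⟨i, hi, hv⟩ => ⟨i, h hi, hv⟩

lemma signedSet_image_rot {p : ℕ} (f : ℕ → α × ℕ) (S : Finset (ℕ × ZMod p)) :
    signedSet f (S.image (rot p)) = fun x => signedSet f S (x - 1) := by
  funext x
  ext v
  rw [mem_signedSet, mem_signedSet]
  refine exists_congr fun i => and_congr_left fun _ => ?_
  simp only [mem_image, rot, Prod.mk.injEq, Prod.exists]
  constructor
  · rintro ⟨i', x', h, rfl, rfl⟩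
    rwa [add_sub_cancel_right]
  · exact fun h => ⟨i, x - 1, h, rfl, sub_add_cancel x 1⟩

lemma hasMonoFamilies_of_prime {p : ℕ} [Fact p.Prime] : HasMonoFamilies α p := by
  intro L R k t g c hLR hk ht hsize hc
  have hp : 2 ≤ p := (Fact.out : p.Prime).two_le
  have hlt : p * (k - 1) + t * (p - 1) < #L + (p - 1) * #R := by
    have h1 : t * (p - 1) ≤ (#R + g) * (p - 1) := Nat.mul_le_mul_right _ ht
    have h2 : p * k = p * (k - 1) + p := by
      rw [← Nat.mul_succ, Nat.succ_eq_add_one, Nat.sub_add_cancel hk]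
    rw [add_mul, mul_comm #R, mul_comm g] at h1
    omega
  obtain ⟨f, hf, hfm⟩ := exists_copies hLR (p - 1) (by omega)
  obtain ⟨s, hs⟩ := exists_sign p (Finset α)
  obtain ⟨s', hs'⟩ := exists_sign p Prop
  by_contra hno
  have hinj : ∀ S, IsFace p (#L + (p - 1) * #R) S → ∀ i j x y, (i, x) ∈ S → (j, y) ∈ S →
      f i = f j → x = y := fun S hS i j x y hi hj hij =>
    congrArg Prod.snd (hS.1 _ hi _ hj (hf (hS.2 _ hi) (hS.2 _ hj) hij))
  have hL : ∀ S, IsFace p (#L + (p - 1) * #R) S → ∀ v ∈ L, ∀ x y, v ∈ signedSet f S x →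
      v ∈ signedSet f S y → x = y := by
    intro S hS v hv x y hx hy
    obtain ⟨i, hi, hiv⟩ := mem_signedSet.1 hx
    obtain ⟨j, hj, hjv⟩ := mem_signedSet.1 hy
    have hz : ∀ i, i < #L + (p - 1) * #R → (f i).1 = v → (f i).2 = 0 := fun i hi hiv =>
      (hfm i hi).elim And.right fun h => (disjoint_left.1 hLR hv (hiv ▸ h.1)).elim
    refine hinj S hS i j x y hi hj (Prod.ext (hiv.trans hjv.symm) ?_)
    rw [hz i (hS.2 _ hi) hiv, hz j (hS.2 _ hj) hjv]
  have hall : ∀ S, IsFace p (#L + (p - 1) * #R) S → ∀ v, ∃ x, v ∉ signedSet f S x := by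
    intro S hS v
    by_contra! hv
    choose i hi hiv using fun x => mem_signedSet.1 (hv x)
    obtain ⟨x, -, y, -, hne, he⟩ := exists_ne_map_eq_of_card_lt_of_maps_to
      (s := (univ : Finset (ZMod p))) (t := range (p - 1)) (f := fun x => (f (i x)).2)
      (by rw [card_univ, ZMod.card, card_range]; omega) (fun x _ => by
        have := hfm (i x) (hS.2 _ (hi x))
        rw [mem_coe, mem_range]
        change (f (i x)).2 < p - 1
        omega)
    exact hne (hinj S hS _ _ x y (hi x) (hi y) (Prod.ext ((hiv x).trans (hiv y).symm) he))
  have hsub : ∀ S, IsFace p (#L + (p - 1) * #R) S → ∀ x, signedSet f S x ⊆ L ∪ R := by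
    intro S hS x v hv
    obtain ⟨i, hi, rfl⟩ := mem_signedSet.1 hv
    exact mem_union.2 ((hfm i (hS.2 _ hi)).imp And.left And.left)
  have hadm : ∀ S, S.Nonempty → IsFace p (#L + (p - 1) * #R) S →
      IsAdmissible k c t (signedSet f S) := by
    intro S hne hS
    refine ⟨?_, hall S hS, fun x B hB hBk => hc B (hB.trans (hsub S hS x)) hBk, ?_⟩
    · obtain ⟨a, ha⟩ := hne
      exact ⟨a.2, _, mem_signedSet.2 ⟨a.1, ha, rfl⟩⟩
    · by_contra! hI
      choose B hB hBk hBc using fun x => (mem_topIndices k c).1 (hI x)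
      have e : Fin p ≃ ZMod p := (ZMod.finEquiv p).toEquiv
      refine hno ⟨fun i => B (e i), topColour k c (signedSet f S), fun i =>
        ⟨(hB _).trans (hsub S hS _), hBk _, hBc _⟩, ?_, ?_⟩
      · intro v hv i j hi hj
        exact e.injective (hL S hS v hv _ _ (hB _ hi) (hB _ hj))
      · intro v _
        obtain ⟨x, hx⟩ := hall S hS v
        refine ⟨e.symm x, fun h => hx ?_⟩
        simp only [e.apply_symm_apply] at h
        exact hB x h
  refine hlt.not_ge (le_of_labelling (fun S => familyLabel k c s s' (signedSet f S))
    (fun S hne hS => ?_) (fun S T hne hST hT => ?_) fun S hne hS => (hadm S hne hS).familyRank_lt)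
  · rw [signedSet_image_rot]
    exact (hadm S hne hS).familyLabel_shift hs hs'
  · exact (hadm S hne (hT.mono hST)).familyLabel_mono (signedSet_mono f hST) s s'

end Prime

section Product

variable {α : Type*} [DecidableEq α]

/-- The inner step for products: a large set carries a monochromatic family. -/
lemma HasMonoFamilies.exists_of_card_eq {b : ℕ} (hb : HasMonoFamilies α b) (hb1 : 1 ≤ b)
    {L R : Finset α} {k t g : ℕ} {c : Finset α → ℕ} (hLR : Disjoint L R) (ht : t ≤ #R + g)
    (hc : ∀ B ⊆ L ∪ R, #B = k → c B < t) {U : Finset α} (hU : U ⊆ L ∪ R)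
    (hUk : #U + 1 = b * k + (b - 1) * g) :
    ∃ (B : Fin b → Finset α) (j : ℕ), (∀ i, B i ⊆ U ∪ R ∧ #(B i) = k ∧ c (B i) = j) ∧
      (∀ x ∈ L, ∀ i i', x ∈ B i → x ∈ B i' → i = i') ∧ ∀ x ∈ R, x ∉ U → ∃ i, x ∉ B i := by
  rcases le_or_gt k #(U ∩ R) with hf | hf
  · obtain ⟨B, hB, hBk⟩ := exists_subset_card_eq hf
    refine ⟨fun _ => B, c B, fun _ => ⟨hB.trans (inter_subset_right.trans subset_union_right),
      hBk, rfl⟩, fun x hx i i' hi _ => ?_, fun x _ hxU => ⟨⟨0, hb1⟩, fun h => ?_⟩⟩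
    · exact (disjoint_left.1 hLR hx (mem_inter.1 (hB hi)).2).elim
    · exact hxU (mem_inter.1 (hB h)).1
  · have hcard : #(U ∩ L) + #(U ∩ R) = #U := by
      rw [← card_union_of_disjoint (hLR.mono inter_subset_right inter_subset_right),
        ← inter_union_distrib_left, inter_eq_left.2 hU]
    have hcR : #(U ∩ R) + #(R \ U) = #R := by
      rw [inter_comm, card_inter_add_card_sdiff]
    have hdisj : ∀ X ⊆ (U ∩ L) ∪ (R \ U), Disjoint X (U ∩ R) := by
      intro X hX
      refine disjoint_left.2 fun x hx hxF => ?_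
      rw [mem_inter] at hxF
      rcases mem_union.1 (hX hx) with h | h
      · exact disjoint_left.1 hLR (mem_inter.1 h).2 hxF.2
      · exact (mem_sdiff.1 h).2 hxF.1
    have hXk : ∀ X ⊆ (U ∩ L) ∪ (R \ U), #X = k - #(U ∩ R) → #(X ∪ (U ∩ R)) = k := by
      intro X hX hk
      rw [card_union_of_disjoint (hdisj X hX), hk, Nat.sub_add_cancel hf.le]
    have hXsub : ∀ X ⊆ (U ∩ L) ∪ (R \ U), X ∪ (U ∩ R) ⊆ U ∪ R := by
      intro X hX
      refine union_subset (hX.trans (union_subset_union inter_subset_left sdiff_subset)) ?_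
      exact inter_subset_left.trans subset_union_left
    obtain ⟨B, j, hB, hBL, hBR⟩ := hb (U ∩ L) (R \ U) (k - #(U ∩ R)) t (g + #(U ∩ R))
      (fun X => c (X ∪ (U ∩ R))) (hLR.mono inter_subset_right sdiff_subset) (by omega) (by omega)
      (by
        obtain ⟨b, rfl⟩ := Nat.exists_eq_add_of_le' hb1
        obtain ⟨m, rfl⟩ := Nat.exists_eq_add_of_le hf.le
        rw [Nat.add_sub_cancel_left, Nat.add_sub_cancel] at *
        nlinarith)
      fun X hX hk => hc _ ((hXsub X hX).trans (union_subset hU subset_union_right)) (hXk X hX hk)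
    refine ⟨fun i => B i ∪ (U ∩ R), j, fun i => ⟨hXsub _ (hB i).1, hXk _ (hB i).1 (hB i).2.1,
      (hB i).2.2⟩, ?_, ?_⟩
    · intro x hx i i' hi hi'
      have hxR := disjoint_left.1 hLR hx
      have h : ∀ i, x ∈ B i ∪ (U ∩ R) → x ∈ B i := fun i hi =>
        (mem_union.1 hi).resolve_right fun h => hxR (mem_inter.1 h).2
      have h1 := h i hi
      refine hBL x ?_ i i' h1 (h i' hi')
      exact (mem_union.1 ((hB i).1 h1)).resolve_right fun h => hxR (mem_sdiff.1 h).1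
    · intro x hx hxU
      obtain ⟨i, hi⟩ := hBR x (mem_sdiff.2 ⟨hx, hxU⟩)
      refine ⟨i, fun h => ?_⟩
      rcases mem_union.1 h with h | h
      · exact hi h
      · exact hxU (mem_inter.1 h).1

lemma HasMonoFamilies.mul {a b : ℕ} (ha : HasMonoFamilies α a) (hb : HasMonoFamilies α b)
    (ha1 : 1 ≤ a) (hb2 : 2 ≤ b) : HasMonoFamilies α (a * b) := by
  intro L R k t g c hLR hk ht hsize hc
  have hK : 1 ≤ b * k + (b - 1) * g - 1 := by
    have := Nat.mul_le_mul hb2 hk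
    omega
  have hin := fun U (hU : U ⊆ L ∪ R ∧ #U = b * k + (b - 1) * g - 1) =>
    hb.exists_of_card_eq (by omega) hLR ht hc hU.1 (by omega)
  classical
  choose B j hB hBL hBR using hin
  obtain ⟨U, J, hU, hUL, hUR⟩ := ha L R (b * k + (b - 1) * g - 1) t g
    (fun U => if h : U ⊆ L ∪ R ∧ #U = b * k + (b - 1) * g - 1 then j U h else 0) hLR hK ht
    (by
      obtain ⟨a, rfl⟩ := Nat.exists_eq_add_of_le' ha1
      obtain ⟨b, rfl⟩ := Nat.exists_eq_add_of_le hb2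
      obtain ⟨m, hm⟩ := Nat.exists_eq_add_of_le' hK
      have h1 : (a + 1) * (2 + b) - 1 = (a + 1) * (1 + b) + a := by
        rw [Nat.sub_eq_iff_eq_add (by nlinarith)]
        ring
      have h2 : (2 + b) * k + (1 + b) * g = m + 2 := by
        have : 2 + b - 1 = 1 + b := by omega
        rw [this] at hm
        have := Nat.mul_le_mul hb2 hk
        omega
      rw [hm, Nat.add_sub_cancel]
      rw [h1] at hsize
      nlinarith)
    (fun U hU hUk => by
      have h : U ⊆ L ∪ R ∧ #U = b * k + (b - 1) * g - 1 := ⟨hU, hUk⟩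
      have := hB U h ⟨0, by omega⟩
      rw [dif_pos h, ← this.2.2]
      exact hc _ (this.1.trans (union_subset hU subset_union_right)) this.2.1)
  have hUh : ∀ i, U i ⊆ L ∪ R ∧ #(U i) = b * k + (b - 1) * g - 1 := fun i =>
    ⟨(hU i).1, (hU i).2.1⟩
  let e : Fin (a * b) ≃ Fin a × Fin b := finProdFinEquiv.symm
  refine ⟨fun i => B (U (e i).1) (hUh _) (e i).2, J, fun i => ?_, fun x hx i i' hi hi' => ?_,
    fun x hx => ?_⟩
  · have h1 := hB _ (hUh (e i).1) (e i).2
    refine ⟨h1.1.trans (union_subset (hU _).1 subset_union_right), h1.2.1, h1.2.2.trans ?_⟩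
    have h2 := (hU (e i).1).2.2
    rwa [dif_pos (hUh (e i).1)] at h2
  · have hmem : ∀ i, x ∈ B (U (e i).1) (hUh _) (e i).2 → x ∈ U (e i).1 := fun i hi =>
      (mem_union.1 ((hB _ (hUh (e i).1) (e i).2).1 hi)).resolve_right (disjoint_left.1 hLR hx)
    have h1 := hUL x hx _ _ (hmem i hi) (hmem i' hi')
    refine e.injective (Prod.ext h1 ?_)
    refine hBL _ (hUh (e i').1) x hx _ _ ?_ hi'
    convert hi using 3
    exact h1.symm
  · obtain ⟨i, hi⟩ := hUR x hx
    obtain ⟨i', hi'⟩ := hBR _ (hUh i) x hx hi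
    refine ⟨e.symm (i, i'), ?_⟩
    simpa using hi'

lemma hasMonoFamilies {r : ℕ} (hr : 2 ≤ r) : HasMonoFamilies α r := by
  induction r using induction_on_primes with
  | zero => omega
  | one => omega
  | prime_mul p a hp ih =>
    have : Fact p.Prime := ⟨hp⟩
    rcases Nat.lt_or_ge a 2 with h | h
    · obtain rfl : a = 1 := by
        interval_cases a
        · omega
        · rfl
      rw [mul_one]
      exact hasMonoFamilies_of_prime
    · exact hasMonoFamilies_of_prime.mul (ih h) hp.one_le h

end Product

end ZpTucker

lemma sum_card_eq_sum_card_filter {n k : ℕ} (e : Multiset (KGSVertex n k)) :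
    Multiset.card e * k = ∑ x : Fin n, Multiset.card (e.filter fun A => x ∈ A.1) := by
  induction e using Multiset.induction_on with
  | empty => simp
  | cons A e ih =>
    have h : ∀ x : Fin n, Multiset.card ((A ::ₘ e).filter fun A => x ∈ A.1) =
        (if x ∈ A.1 then 1 else 0) + Multiset.card (e.filter fun A => x ∈ A.1) := by
      intro x
      split_ifs with hx
      · rw [Multiset.filter_cons_of_pos
          (p := fun A : KGSVertex n k => x ∈ A.1) e hx, Multiset.card_cons, add_comm]
      · rw [Multiset.filter_cons_of_neg
          (p := fun A : KGSVertex n k => x ∈ A.1) e hx, zero_add]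
    rw [sum_congr rfl fun x _ => h x, sum_add_distrib, ← ih, Multiset.card_cons, add_one_mul,
      sum_boole, filter_univ_mem, A.2, Nat.cast_id, add_comm]

lemma exists_properColoring {n k r : ℕ} (hk : 1 ≤ k) (hr : 2 ≤ r) (hn : r * k ≤ n) :
    ∃ c : KGSVertex n k → Fin (n - r * k + 2),
      IsProperColoring (KGSEdges n k r (fun i => if i.val + 1 < k * r then 1 else r - 1)) c := by
  classical
  let P : KGSVertex n k → Fin n → Prop := fun A i => i ∈ A.1 ∧ k * r ≤ i.val + 1
  let c : KGSVertex n k → Fin (n - r * k + 2) := fun A =>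
    if h : ∃ i, P A i then ⟨h.choose.val + 1 - r * k, by omega⟩ else ⟨n - r * k + 1, by omega⟩
  have hc : ∀ A, (∃ i, P A i ∧ i.val + 1 = k * r + (c A).val) ∨
      (c A).val = n - r * k + 1 ∧ ∀ i ∈ A.1, i.val + 1 < k * r := by
    intro A
    by_cases h : ∃ i, P A i
    · refine Or.inl ⟨h.choose, h.choose_spec, ?_⟩
      have := h.choose_spec.2
      simp only [c, dif_pos h, mul_comm r k]
      omega
    · refine Or.inr ⟨by simp only [c, dif_neg h], fun i hi => ?_⟩
      by_contra! hle
      exact h ⟨i, hi, hle⟩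
  refine ⟨c, fun e he => ?_⟩
  by_contra! hmono
  obtain ⟨hcard, hmul⟩ := he
  beta_reduce at hmul
  obtain ⟨A, hA⟩ := Multiset.card_pos_iff_exists_mem.1 (by omega : 0 < Multiset.card e)
  rcases hc A with ⟨i, hi, hci⟩ | ⟨hcA, -⟩
  · have hall : ∀ B ∈ e, i ∈ B.1 := by
      intro B hB
      rw [hmono A hA B hB] at hci
      rcases hc B with ⟨j, hj, hcj⟩ | ⟨hcB, -⟩
      · rw [Fin.ext (by omega : i.val = j.val)]
        exact hj.1
      · have := i.2
        rw [mul_comm k r] at hci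
        omega
    have h := hmul i
    rw [Multiset.filter_eq_self.2 hall, hcard, if_neg (not_lt.2 hi.2)] at h
    omega
  · have hall : ∀ B ∈ e, ∀ i ∈ B.1, i.val + 1 < k * r := by
      intro B hB
      rw [hmono A hA B hB] at hcA
      rcases hc B with ⟨j, hj, hcj⟩ | ⟨-, h⟩
      · have := j.2
        rw [mul_comm k r] at hcj
        omega
      · exact h
    have hle : ∀ x : Fin n, Multiset.card (e.filter fun A => x ∈ A.1) ≤
        if x.val < k * r - 1 then 1 else 0 := by
      intro x
      have := hmul x
      split_ifs at this ⊢
      · exact this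
      · omega
      · rw [Nat.le_zero, Multiset.card_eq_zero, Multiset.filter_eq_nil]
        exact fun B hB hx => absurd (hall B hB x hx) (by omega)
      · rw [Nat.le_zero, Multiset.card_eq_zero, Multiset.filter_eq_nil]
        exact fun B hB hx => absurd (hall B hB x hx) (by omega)
    have h := sum_le_sum fun x (_ : x ∈ (univ : Finset (Fin n))) => hle x
    rw [← sum_card_eq_sum_card_filter, sum_boole, Fin.card_filter_val_lt, hcard, Nat.cast_id,
      mul_comm r k] at h
    have := Nat.mul_pos hk (by omega : 0 < r)
    omega

lemma le_of_properColoring {n k r t : ℕ} (hk : 1 ≤ k) (hr : 2 ≤ r) (hn : r * k ≤ n)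
    {c : KGSVertex n k → Fin t}
    (hc : IsProperColoring
      (KGSEdges n k r (fun i => if i.val + 1 < k * r then 1 else r - 1)) c) :
    n - r * k + 2 ≤ t := by
  by_contra! ht
  have hpos : 0 < k * r := Nat.mul_pos hk (by omega)
  have hL : #{i : Fin n | i.val < k * r - 1} = k * r - 1 := by
    rw [Fin.card_filter_val_lt, mul_comm]
    omega
  have hR := card_filter_add_card_filter_not (s := univ) fun i : Fin n => i.val < k * r - 1
  rw [hL, card_univ, Fintype.card_fin] at hR
  obtain ⟨B, j, hB, hBL, hBR⟩ := ZpTucker.hasMonoFamilies hr {i : Fin n | i.val < k * r - 1}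
    {i : Fin n | ¬ i.val < k * r - 1} k t 0 (fun B => if h : #B = k then (c ⟨B, h⟩).val else 0)
    (disjoint_filter_filter_not _ _ _) hk (by rw [mul_comm r k] at *; omega)
    (by rw [hL, mul_comm]; omega) (fun B _ h => by simp only [dif_pos h]; exact (c _).2)
  let A : Fin r → KGSVertex n k := fun i => ⟨B i, (hB i).2.1⟩
  have hcA : ∀ i, (c (A i)).val = j := fun i => by
    have := (hB i).2.2
    rwa [dif_pos (hB i).2.1] at this
  have he : univ.val.map A ∈
      KGSEdges n k r (fun i => if i.val + 1 < k * r then 1 else r - 1) := by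
    refine ⟨by simp, fun x => ?_⟩
    rw [Multiset.filter_map, Multiset.card_map]
    change #{i | x ∈ B i} ≤ if x.val + 1 < k * r then 1 else r - 1
    split_ifs with hx
    · refine card_le_one.2 fun i hi i' hi' => ?_
      exact hBL x (mem_filter.2 ⟨mem_univ x, by omega⟩) i i' (mem_filter.1 hi).2
        (mem_filter.1 hi').2
    · obtain ⟨i, hi⟩ := hBR x (mem_filter.2 ⟨mem_univ x, by omega⟩)
      have := card_lt_univ_of_notMem (s := {i | x ∈ B i}) (x := i) (by simpa using hi)
      rw [Fintype.card_fin] at this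
      omega
  obtain ⟨a, ha, b, hb, hab⟩ := hc _ he
  obtain ⟨i, -, rfl⟩ := Multiset.mem_map.1 ha
  obtain ⟨i', -, rfl⟩ := Multiset.mem_map.1 hb
  exact hab (Fin.ext ((hcA i).trans (hcA i').symm))

theorem chromatic_KGS_mixed_eq (n k r : ℕ)
    (hk : 1 ≤ k) (hr : 2 ≤ r) (hn : r * k ≤ n) :
    hypChromatic (KGSEdges n k r (fun i => if i.val + 1 < k * r then 1 else r - 1)) =
      ((n - r * k + 2 : ℕ) : ℕ∞) := by
  refine le_antisymm (sInf_le ⟨_, rfl, exists_properColoring hk hr hn⟩) (le_sInf ?_)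
  rintro _ ⟨t, rfl, c, hc⟩
  exact Nat.cast_le.2 (le_of_properColoring hk hr hn hc)
end

section
/- For s : [n] → {0,...,r} with s(1) + ... + s(n) ≥ rk, the complex C_s(n, k, ..., k) (k repeated r times) is (s(1) + ... + s(n) - rk - 1)-connected. -/
open Finset Topology

/-- The geometric realization of an abstract simplicial complex given by its set `K` of
faces: formal convex combinations of vertices supported on a face. -/
def realization {V : Type*} (K : Set (Finset V)) : Type _ :=
  {w : V → ℝ // (∃ s ∈ K, ∀ v, w v ≠ 0 → v ∈ s) ∧ (∀ v, 0 ≤ w v) ∧ ∑ᶠ v, w v = 1}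

instance {V : Type*} (K : Set (Finset V)) : TopologicalSpace (realization K) :=
  inferInstanceAs (TopologicalSpace {w : V → ℝ //
    (∃ s ∈ K, ∀ v, w v ≠ 0 → v ∈ s) ∧ (∀ v, 0 ≤ w v) ∧ ∑ᶠ v, w v = 1})

/-- `c`-connectedness of a space, for `c : ℤ`: non-empty when `c ≥ -1`, and all homotopy
groups `π_i` vanish for `0 ≤ i ≤ c`.  Every space is `c`-connected for `c ≤ -2`. -/
def IsNConnected (c : ℤ) (X : Type*) [TopologicalSpace X] : Prop :=
  ((-1 : ℤ) ≤ c → Nonempty X) ∧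
    ∀ i : ℕ, (i : ℤ) ≤ c → ∀ x : X, Subsingleton (π_ i X x)

variable (n r : ℕ) (s : Fin n → ℕ) (k : Fin r → ℕ)

/-- An `r`-tuple of subsets of `[n]` is `s`-disjoint if each `x` lies in at most `s x`
of the sets. -/
def SDisjoint (A : Fin r → Finset (Fin n)) : Prop :=
  ∀ x : Fin n, (Finset.univ.filter (fun i => x ∈ A i)).card ≤ s x

/-- Vertices of `K_s(n, k₁, …, k_r)`: `s`-disjoint tuples with `|A_i| = k_i`. -/
def KsVert : Type :=
  {A : Fin r → Finset (Fin n) // (∀ i, (A i).card = k i) ∧ SDisjoint n r s A}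

/-- Faces of `K_s(n, 𝐤)`: sets of tuples all of whose mixed tuples are `s`-disjoint. -/
def KsFaces : Set (Finset (KsVert n r s k)) :=
  {σ | ∀ g : Fin r → KsVert n r s k, (∀ j, g j ∈ σ) →
    SDisjoint n r s (fun j => (g j).1 j)}

/-- Vertices of `C_s(n, k₁, …, k_r)`: tuples with `|A_i| ≥ k_i` and each `x` in exactly
`s x` of the sets. -/
def CsVert : Type :=
  {A : Fin r → Finset (Fin n) // (∀ i, k i ≤ (A i).card) ∧
    ∀ x : Fin n, (Finset.univ.filter (fun i => x ∈ A i)).card = s x}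

/-- Faces of `C_s(n, 𝐤)`: collections whose coordinatewise intersections have size `≥ k_j`. -/
def CsFace (σ : Finset (CsVert n r s k)) : Prop :=
  ∀ j, k j ≤ (σ.inf (fun A => A.1 j)).card

/-- A maximal face of `K_s(n, 𝐤)`. -/
def IsMaxKsFace (F : Finset (KsVert n r s k)) : Prop :=
  F ∈ KsFaces n r s k ∧ ∀ G ∈ KsFaces n r s k, F ⊆ G → F = G

open scoped NNReal

/-- `DimLT p Z` is a closed-cover form of the statement that the large inductive dimension of
`Z` is less than `p`. -/
def DimLT {T : Type*} [TopologicalSpace T] : ℕ → Set T → Prop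
  | 0, Z => Z = ∅
  | p + 1, Z => ∀ E F : Set T, IsClosed E → IsClosed F → Disjoint E F →
      ∃ Z₁ Z₂ : Set T, IsClosed Z₁ ∧ IsClosed Z₂ ∧ Z ⊆ Z₁ ∪ Z₂ ∧ Disjoint Z₁ F ∧
        Disjoint Z₂ E ∧ DimLT p (Z ∩ (Z₁ ∩ Z₂))

theorem DimLT.mono {T : Type*} [TopologicalSpace T] {p : ℕ} {Z Z' : Set T} (h : DimLT p Z)
    (hZ : Z' ⊆ Z) : DimLT p Z' := by
  induction p generalizing Z Z' with
  | zero => exact Set.subset_eq_empty hZ h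
  | succ p ih =>
    intro E F hE hF hEF
    obtain ⟨Z₁, Z₂, h₁, h₂, hc, hF', hE', hd⟩ := h E F hE hF hEF
    exact ⟨Z₁, Z₂, h₁, h₂, hZ.trans hc, hF', hE',
      ih hd (Set.inter_subset_inter_left _ hZ)⟩

/-- `X` is an absolute extensor for the closed subsets of `T` of dimension less than `p`. -/
def Extensor (T : Type*) [TopologicalSpace T] {Y : Type*} [TopologicalSpace Y] (p : ℕ)
    (X : Set Y) : Prop :=
  ∀ Z A : Set T, IsClosed Z → IsClosed A → A ⊆ Z → DimLT p Z →
    ∀ a : T → Y, ContinuousOn a A → Set.MapsTo a A X →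
      ∃ b : T → Y, ContinuousOn b Z ∧ Set.MapsTo b Z X ∧ Set.EqOn b a A

theorem Extensor.zero {T : Type*} [TopologicalSpace T] {Y : Type*} [TopologicalSpace Y]
    (X : Set Y) : Extensor T 0 X := by
  rintro Z A - - hA rfl a - -
  rw [Set.subset_empty_iff] at hA
  subst hA
  exact ⟨a, continuousOn_empty _, Set.mapsTo_empty _ _, fun _ _ => rfl⟩

theorem exists_continuousOn_union {T : Type*} [TopologicalSpace T] {Y : Type*}
    [TopologicalSpace Y] {S₁ S₂ : Set T} (h₁ : IsClosed S₁) (h₂ : IsClosed S₂) {f₁ f₂ : T → Y}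
    (hf₁ : ContinuousOn f₁ S₁) (hf₂ : ContinuousOn f₂ S₂) (h : Set.EqOn f₁ f₂ (S₁ ∩ S₂)) :
    ∃ g : T → Y, ContinuousOn g (S₁ ∪ S₂) ∧ Set.EqOn g f₁ S₁ ∧ Set.EqOn g f₂ S₂ := by
  classical
  have e₁ : Set.EqOn (S₁.piecewise f₁ f₂) f₁ S₁ := S₁.piecewise_eqOn f₁ f₂
  have e₂ : Set.EqOn (S₁.piecewise f₁ f₂) f₂ S₂ := by
    intro x hx
    by_cases hx₁ : x ∈ S₁
    · rw [e₁ hx₁, h ⟨hx₁, hx⟩]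
    · exact Set.piecewise_eq_of_notMem _ _ _ hx₁
  exact ⟨_, (hf₁.congr e₁).union_of_isClosed (hf₂.congr e₂) h₁ h₂, e₁, e₂⟩

theorem Extensor.union {T : Type*} [TopologicalSpace T] {Y : Type*} [TopologicalSpace Y]
    {p : ℕ} {X₁ X₂ : Set Y} (ho₁ : IsOpen X₁) (ho₂ : IsOpen X₂) (h₁ : Extensor T (p + 1) X₁)
    (h₂ : Extensor T (p + 1) X₂) (h₁₂ : Extensor T p (X₁ ∩ X₂)) :
    Extensor T (p + 1) (X₁ ∪ X₂) := by
  intro Z A hZ hA hAZ hdim a ha haX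
  obtain ⟨Z₁, Z₂, hZ₁, hZ₂, hcov, hd₁, hd₂, hd⟩ := hdim (A ∩ a ⁻¹' X₂ᶜ) (A ∩ a ⁻¹' X₁ᶜ)
    (ha.preimage_isClosed_of_isClosed hA ho₂.isClosed_compl)
    (ha.preimage_isClosed_of_isClosed hA ho₁.isClosed_compl)
    (Set.disjoint_left.2 fun x hx hx' => (haX hx.1).elim hx'.2 hx.2)
  have m₁ : Set.MapsTo a (A ∩ Z₁) X₁ := fun x hx => by
    by_contra hcon
    exact Set.disjoint_left.1 hd₁ hx.2 ⟨hx.1, hcon⟩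
  have m₂ : Set.MapsTo a (A ∩ Z₂) X₂ := fun x hx => by
    by_contra hcon
    exact Set.disjoint_left.1 hd₂ hx.2 ⟨hx.1, hcon⟩
  have hL : IsClosed (Z ∩ (Z₁ ∩ Z₂)) := hZ.inter (hZ₁.inter hZ₂)
  obtain ⟨c, hc, hcX, hca⟩ := h₁₂ (Z ∩ (Z₁ ∩ Z₂)) (A ∩ (Z₁ ∩ Z₂)) hL
    (hA.inter (hZ₁.inter hZ₂)) (Set.inter_subset_inter_left _ hAZ) hd a
    (ha.mono Set.inter_subset_left)
    fun x hx => ⟨m₁ ⟨hx.1, hx.2.1⟩, m₂ ⟨hx.1, hx.2.2⟩⟩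
  have extend : ∀ (Z' : Set T) (X' : Set Y), IsClosed Z' → Z₁ ∩ Z₂ ⊆ Z' →
      (∀ x ∈ Z ∩ (Z₁ ∩ Z₂), c x ∈ X') → Set.MapsTo a (A ∩ Z') X' → Extensor T (p + 1) X' →
      ∃ b : T → Y, ContinuousOn b (Z ∩ Z') ∧ Set.MapsTo b (Z ∩ Z') X' ∧
        Set.EqOn b a (A ∩ Z') ∧ Set.EqOn b c (Z ∩ (Z₁ ∩ Z₂)) := by
    intro Z' X' hZ' hsub hcX' ha' hX'
    obtain ⟨a', ha'c, ha'1, ha'2⟩ := exists_continuousOn_union (hA.inter hZ') hL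
      (ha.mono Set.inter_subset_left) hc
      (fun x hx => (hca ⟨hx.1.1, hx.2.2⟩).symm)
    obtain ⟨b, hb, hbX, hba⟩ := hX' (Z ∩ Z') ((A ∩ Z') ∪ (Z ∩ (Z₁ ∩ Z₂))) (hZ.inter hZ')
      ((hA.inter hZ').union hL)
      (Set.union_subset (Set.inter_subset_inter_left _ hAZ) (Set.inter_subset_inter_right _ hsub))
      (hdim.mono Set.inter_subset_left) a' ha'c (by
        rintro x (hx | hx)
        · rw [ha'1 hx]; exact ha' hx
        · rw [ha'2 hx]; exact hcX' x hx)
    exact ⟨b, hb, hbX, fun x hx => (hba (Or.inl hx)).trans (ha'1 hx),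
      fun x hx => (hba (Or.inr hx)).trans (ha'2 hx)⟩
  obtain ⟨b₁, hb₁, hbX₁, hba₁, hbc₁⟩ := extend Z₁ X₁ hZ₁ Set.inter_subset_left
    (fun x hx => (hcX hx).1) m₁ h₁
  obtain ⟨b₂, hb₂, hbX₂, hba₂, hbc₂⟩ := extend Z₂ X₂ hZ₂ Set.inter_subset_right
    (fun x hx => (hcX hx).2) m₂ h₂
  obtain ⟨b, hb, hbb₁, hbb₂⟩ := exists_continuousOn_union (hZ.inter hZ₁) (hZ.inter hZ₂) hb₁ hb₂
    (fun x hx => by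
      have hx' : x ∈ Z ∩ (Z₁ ∩ Z₂) := ⟨hx.1.1, hx.1.2, hx.2.2⟩
      rw [hbc₁ hx', hbc₂ hx'])
  have hcov' : ∀ x ∈ Z, x ∈ Z ∩ Z₁ ∨ x ∈ Z ∩ Z₂ := fun x hx =>
    (hcov hx).imp (fun h => ⟨hx, h⟩) fun h => ⟨hx, h⟩
  refine ⟨b, hb.mono hcov', fun x hx => ?_, fun x hx => ?_⟩
  · rcases hcov' x hx with h | h
    · rw [hbb₁ h]; exact Or.inl (hbX₁ h)
    · rw [hbb₂ h]; exact Or.inr (hbX₂ h)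
  · rcases hcov' x (hAZ hx) with h | h
    · rw [hbb₁ h, hba₁ ⟨hx, h.2⟩]
    · rw [hbb₂ h, hba₂ ⟨hx, h.2⟩]

theorem exists_continuous_eqOn {T : Type} [TopologicalSpace T] [NormalSpace T] {V : Type*}
    {A : Set T} (hA : IsClosed A) {a : T → V → ℝ≥0} (ha : ContinuousOn a A) :
    ∃ g : T → V → ℝ≥0, Continuous g ∧ Set.EqOn g a A := by
  obtain ⟨g, hg⟩ := ContinuousMap.exists_restrict_eq hA
    (⟨A.domRestrict a, ha.domRestrict⟩ : C(A, V → ℝ≥0))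
  exact ⟨g, g.continuous, fun x hx => DFunLike.congr_fun hg ⟨x, hx⟩⟩

/-- Homotopy extension along line segments for maps into an open set. -/
theorem exists_extension_of_segment {T : Type} [TopologicalSpace T] [NormalSpace T] {V : Type*}
    {X : Set (V → ℝ≥0)} (hX : IsOpen X) {Z A : Set T} (hZ : IsClosed Z) (hA : IsClosed A)
    {a b : T → V → ℝ≥0} (ha : ContinuousOn a A) (hb : ContinuousOn b Z) (hbX : Set.MapsTo b Z X)
    (hAZ : A ⊆ Z)
    (h : ∀ z ∈ A, ∀ μ ν : ℝ≥0, μ + ν = 1 → μ • a z + ν • b z ∈ X) :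
    ∃ c : T → V → ℝ≥0, ContinuousOn c Z ∧ Set.MapsTo c Z X ∧ Set.EqOn c a A := by
  obtain ⟨a', ha', haa'⟩ := exists_continuous_eqOn hA ha
  obtain ⟨b', hb', hbb'⟩ := exists_continuous_eqOn hZ hb
  let P : T × ℝ → V → ℝ≥0 := fun q => (1 - q.2).toNNReal • a' q.1 + q.2.toNNReal • b' q.1
  have hP : Continuous P := by
    have := ha'.comp continuous_fst (X := T × ℝ)
    have := hb'.comp continuous_fst (X := T × ℝ)
    fun_prop
  have sum_one : ∀ t ∈ Set.Icc (0 : ℝ) 1, (1 - t).toNNReal + t.toNNReal = 1 := by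
    intro t ht
    rw [← Real.toNNReal_add (by linarith [ht.2]) ht.1]
    simp
  let O : Set T := interior {z | ∀ t ∈ Set.Icc (0 : ℝ) 1, P (z, t) ∈ X}
  have hAO : A ⊆ O := by
    intro z hz
    refine mem_interior_iff_mem_nhds.2 (isCompact_Icc.eventually_forall_of_forall_eventually ?_)
    intro t ht
    refine hP.continuousAt.eventually_mem (hX.mem_nhds ?_)
    have := h z hz _ _ (sum_one t ht)
    simpa only [P, haa' hz, hbb' (hAZ hz)] using this
  obtain ⟨l, hl0, hl1, hl⟩ := exists_continuous_zero_one_of_isClosed hA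
    (isOpen_interior (s := {z | ∀ t ∈ Set.Icc (0 : ℝ) 1, P (z, t) ∈ X})).isClosed_compl
    (Set.disjoint_compl_right_iff_subset.2 hAO)
  refine ⟨fun z => P (z, l z), ?_, ?_, ?_⟩
  · exact (hP.comp (by fun_prop)).continuousOn
  · intro z hz
    by_cases hzO : z ∈ O
    · exact interior_subset hzO (l z) (hl z)
    · have : l z = 1 := hl1 hzO
      simpa [P, this, hbb' hz] using hbX hz
  · intro z hz
    have : l z = 0 := hl0 hz
    simpa [P, this] using haa' hz

theorem sup_eq_iff_of_le {α : Type*} [LinearOrder α] {a b c : α} (ha : a ≤ c) (hb : b ≤ c) :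
    a ⊔ b = c ↔ a = c ∨ b = c := by
  constructor
  · rintro rfl
    exact (le_total a b).symm.imp (fun h => (sup_eq_left.2 h).symm)
      fun h => (sup_eq_right.2 h).symm
  · rintro (rfl | rfl)
    · exact sup_eq_left.2 hb
    · exact sup_eq_right.2 ha

/-- The nonnegative functions on the vertices whose set of maximum points is a face of `K`. -/
def peakSet {V : Type*} (K : Set (Finset V)) : Set (V → ℝ≥0) :=
  {w | ∃ M : ℝ≥0, 0 < M ∧ ∃ σ ∈ K, σ.Nonempty ∧ (∀ v, w v ≤ M) ∧ ∀ v, w v = M ↔ v ∈ σ}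

theorem peakSet_congr {V : Type*} {K L : Set (Finset V)}
    (h : ∀ σ : Finset V, σ.Nonempty → (σ ∈ K ↔ σ ∈ L)) : peakSet K = peakSet L := by
  ext w
  constructor
  · rintro ⟨M, hM, σ, hσ, hne, hw⟩
    exact ⟨M, hM, σ, (h σ hne).1 hσ, hne, hw⟩
  · rintro ⟨M, hM, σ, hσ, hne, hw⟩
    exact ⟨M, hM, σ, (h σ hne).2 hσ, hne, hw⟩

theorem peakSet_union {V : Type*} (K L : Set (Finset V)) :
    peakSet (K ∪ L) = peakSet K ∪ peakSet L := by
  ext w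
  constructor
  · rintro ⟨M, hM, σ, hσ | hσ, hne, hw⟩
    · exact Or.inl ⟨M, hM, σ, hσ, hne, hw⟩
    · exact Or.inr ⟨M, hM, σ, hσ, hne, hw⟩
  · rintro (⟨M, hM, σ, hσ, hne, hw⟩ | ⟨M, hM, σ, hσ, hne, hw⟩)
    · exact ⟨M, hM, σ, Or.inl hσ, hne, hw⟩
    · exact ⟨M, hM, σ, Or.inr hσ, hne, hw⟩

theorem peakSet_inter {V : Type*} (K L : Set (Finset V)) :
    peakSet (K ∩ L) = peakSet K ∩ peakSet L := by
  ext w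
  constructor
  · rintro ⟨M, hM, σ, ⟨hK, hL⟩, hne, hw⟩
    exact ⟨⟨M, hM, σ, hK, hne, hw⟩, ⟨M, hM, σ, hL, hne, hw⟩⟩
  · rintro ⟨⟨M, hM, σ, hK, ⟨v, hv⟩, hw, hw'⟩, ⟨M', hM', σ', hL, ⟨v', hv'⟩, hu, hu'⟩⟩
    have e : M = M' := le_antisymm ((hw' v).2 hv ▸ hu v) ((hu' v').2 hv' ▸ hw v')
    subst e
    have e : σ = σ' := by
      ext x
      rw [← hw', ← hu']
    subst e
    exact ⟨M, hM, σ, ⟨hK, hL⟩, ⟨v, hv⟩, hw, hw'⟩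

theorem isOpen_peakSet {V : Type*} [Finite V] {K : Set (Finset V)}
    (hK : ∀ σ ∈ K, ∀ τ ⊆ σ, τ.Nonempty → τ ∈ K) : IsOpen (peakSet K) := by
  classical
  have := Fintype.ofFinite V
  rw [isOpen_iff_forall_mem_open]
  rintro w ⟨M, hM, σ, hσ, ⟨v₀, hv₀⟩, hw, hw'⟩
  refine ⟨{u | 0 < u v₀ ∧ ∀ v, v ∉ σ → u v < u v₀}, ?_, ?_, ?_, ?_⟩
  · rintro u ⟨hpos, hu⟩
    obtain ⟨m, -, hm⟩ := Finset.exists_max_image Finset.univ u ⟨v₀, Finset.mem_univ _⟩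
    have hsub : Finset.univ.filter (fun v => u v = u m) ⊆ σ := by
      intro v hv
      by_contra hcon
      have h₁ := hu v hcon
      have h₂ := hm v₀ (Finset.mem_univ _)
      rw [(Finset.mem_filter.1 hv).2] at h₁
      exact absurd h₁ h₂.not_gt
    have hne : (Finset.univ.filter (fun v => u v = u m)).Nonempty := ⟨m, by simp⟩
    exact ⟨u m, hpos.trans_le (hm v₀ (Finset.mem_univ _)), _, hK σ hσ _ hsub hne, hne,
      fun v => hm v (Finset.mem_univ _), by simp⟩
  · simp only [Set.ofPred_and, Set.ofPred_forall]
    refine (isOpen_lt (by fun_prop) (by fun_prop)).inter ?_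
    refine isOpen_iInter_of_finite fun v => isOpen_iInter_of_finite fun _ =>
      isOpen_lt (by fun_prop) (by fun_prop)
  · rwa [(hw' v₀).2 hv₀]
  · intro v hv
    rw [(hw' v₀).2 hv₀]
    exact lt_of_le_of_ne (hw v) fun h => hv ((hw' v).1 h)

open Classical in
/-- Push-forward of a function along a map of vertices, by taking suprema over the fibres. -/
noncomputable def supMap {V V' : Type*} [Fintype V] (f : V → V') (w : V → ℝ≥0) : V' → ℝ≥0 :=
  fun v' => Finset.univ.sup fun v => if f v = v' then w v else 0

theorem continuous_supMap {V V' : Type*} [Fintype V] (f : V → V') :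
    Continuous (supMap f) := by
  refine continuous_pi fun v' => ?_
  refine Continuous.finset_sup_apply fun v _ => ?_
  split_ifs <;> fun_prop

theorem supMap_peak {V V' : Type*} [Fintype V] [DecidableEq V'] (f : V → V') {w : V → ℝ≥0}
    {M : ℝ≥0} (hM : 0 < M) {σ : Finset V} (hw : ∀ v, w v ≤ M) (hw' : ∀ v, w v = M ↔ v ∈ σ) :
    (∀ v', supMap f w v' ≤ M) ∧ ∀ v', supMap f w v' = M ↔ v' ∈ σ.image f := by
  have hle : ∀ v', supMap f w v' ≤ M := by
    intro v'
    refine Finset.sup_le fun v _ => ?_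
    split_ifs
    · exact hw v
    · exact hM.le
  refine ⟨hle, fun v' => ⟨fun h => ?_, fun h => ?_⟩⟩
  · by_contra hcon
    refine h.not_lt ((Finset.sup_lt_iff hM).2 fun v _ => ?_)
    split_ifs with hv
    · refine lt_of_le_of_ne (hw v) fun hvM => hcon ?_
      exact Finset.mem_image.2 ⟨v, (hw' v).1 hvM, hv⟩
    · exact hM
  · obtain ⟨v, hv, rfl⟩ := Finset.mem_image.1 h
    refine le_antisymm (hle _) ?_
    rw [← (hw' v).2 hv]
    exact Finset.le_sup_of_le (Finset.mem_univ v) (by simp)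

/-- A segment between two comparable points with the same maximum stays in `peakSet K` when its
ends do. -/
theorem smul_add_smul_mem_peakSet {V : Type*} {K : Set (Finset V)} {w u : V → ℝ≥0} {M : ℝ≥0}
    (hM : 0 < M) {σ τ : Finset V} (hσ : σ ∈ K) (hτ : τ ∈ K) (hne : σ.Nonempty) (hwu : w ≤ u)
    (hw' : ∀ v, w v = M ↔ v ∈ σ) (hu : ∀ v, u v ≤ M)
    (hu' : ∀ v, u v = M ↔ v ∈ τ) {μ ν : ℝ≥0} (h : μ + ν = 1) : μ • w + ν • u ∈ peakSet K := by
  have hστ : σ ⊆ τ := fun v hv =>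
    (hu' v).1 (le_antisymm (hu v) (((hw' v).2 hv).symm.le.trans (hwu v)))
  have key : ∀ v, (μ • w + ν • u) v = μ * w v + ν * u v := fun v => rfl
  have hone : μ * M + ν * M = M := by rw [← add_mul, h, one_mul]
  rcases eq_or_ne μ 0 with rfl | hμ
  · obtain rfl : ν = 1 := by simpa using h
    refine ⟨M, hM, τ, hτ, hne.mono hστ, ?_, ?_⟩ <;> simpa [key]
  · refine ⟨M, hM, σ, hσ, hne, fun v => ?_, fun v => ⟨fun hv => ?_, fun hv => ?_⟩⟩
    · rw [key]
      calc μ * w v + ν * u v ≤ μ * M + ν * M := by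
            gcongr
            exacts [(hwu v).trans (hu v), hu v]
        _ = M := hone
    · rw [key] at hv
      rw [← hw']
      refine ((hwu v).trans (hu v)).eq_of_not_lt fun hlt => hv.not_lt ?_
      calc μ * w v + ν * u v < μ * M + ν * M := by
            refine add_lt_add_of_lt_of_le ?_ (mul_le_mul_right (hu v) ν)
            exact mul_lt_mul_of_pos_left hlt (pos_iff_ne_zero.2 hμ)
        _ = M := hone
    · rw [key, (hw' v).2 hv, (hu' v).2 (hστ hv), hone]

theorem Extensor.of_contiguous {T : Type} [TopologicalSpace T] [NormalSpace T] {V V' : Type*}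
    [Fintype V] [Fintype V'] [DecidableEq V] [DecidableEq V'] {K : Set (Finset V)}
    {K' : Set (Finset V')} (hK : ∀ σ ∈ K, ∀ τ ⊆ σ, τ.Nonempty → τ ∈ K) (f : V → V') (g : V' → V)
    (hf : ∀ σ ∈ K, σ.Nonempty → σ.image f ∈ K') (hg : ∀ σ ∈ K', σ.Nonempty → σ.image g ∈ K)
    (hfg : ∀ σ ∈ K, σ.Nonempty → σ ∪ (σ.image f).image g ∈ K) {p : ℕ}
    (h : Extensor T p (peakSet K')) : Extensor T p (peakSet K) := by
  intro Z A hZ hA hAZ hdim a ha haK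
  have hfc := (continuous_supMap f).comp_continuousOn ha
  have hgfc := (continuous_supMap g).comp_continuousOn hfc
  obtain ⟨b, hb, hbK, hba⟩ := h Z A hZ hA hAZ hdim (fun z => supMap f (a z)) hfc fun z hz => by
    obtain ⟨M, hM, σ, hσ, hne, hw, hw'⟩ := haK hz
    have := supMap_peak f hM hw hw'
    exact ⟨M, hM, _, hf σ hσ hne, hne.image f, this.1, this.2⟩
  obtain ⟨c, hc, hcK, hca⟩ := exists_extension_of_segment (isOpen_peakSet hK) hZ hA
    (a := fun z => a z ⊔ supMap g (supMap f (a z))) (b := fun z => supMap g (b z))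
    (continuousOn_pi.2 fun v => ((continuous_apply v).comp_continuousOn ha).sup
      ((continuous_apply v).comp_continuousOn hgfc)) ((continuous_supMap g).comp_continuousOn hb)
    (fun z hz => by
      obtain ⟨M, hM, σ, hσ, hne, hw, hw'⟩ := hbK hz
      have := supMap_peak g hM hw hw'
      exact ⟨M, hM, _, hg σ hσ hne, hne.image g, this.1, this.2⟩) hAZ
    (fun z hz μ ν hμν => by
      obtain ⟨M, hM, σ, hσ, hne, hw, hw'⟩ := haK hz
      have h₁ := supMap_peak f hM hw hw'
      have h₂ := supMap_peak g hM h₁.1 h₁.2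
      rw [hba hz, add_comm]
      refine smul_add_smul_mem_peakSet hM (hg _ (hf σ hσ hne) (hne.image f)) (hfg σ hσ hne)
        ((hne.image f).image g) le_sup_right h₂.2 (fun v => sup_le (hw v) (h₂.1 v))
        (fun v => ?_) ((add_comm ν μ).trans hμν)
      rw [Finset.mem_union, ← hw', ← h₂.2]
      exact sup_eq_iff_of_le (hw v) (h₂.1 v))
  refine exists_extension_of_segment (isOpen_peakSet hK) hZ hA ha hc hcK hAZ ?_
  intro z hz μ ν hμν
  obtain ⟨M, hM, σ, hσ, hne, hw, hw'⟩ := haK hz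
  have h₁ := supMap_peak f hM hw hw'
  have h₂ := supMap_peak g hM h₁.1 h₁.2
  rw [hca hz]
  refine smul_add_smul_mem_peakSet hM hσ (hfg σ hσ hne) hne le_sup_left hw'
    (fun v => sup_le (hw v) (h₂.1 v)) (fun v => ?_) hμν
  rw [Finset.mem_union, ← hw', ← h₂.2]
  exact sup_eq_iff_of_le (hw v) (h₂.1 v)

theorem Extensor.of_cone {T : Type} [TopologicalSpace T] [NormalSpace T] {V : Type*}
    [Fintype V] [DecidableEq V] {K : Set (Finset V)}
    (hK : ∀ σ ∈ K, ∀ τ ⊆ σ, τ.Nonempty → τ ∈ K) (v₀ : V) (h₀ : {v₀} ∈ K)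
    (h : ∀ σ ∈ K, insert v₀ σ ∈ K) (p : ℕ) : Extensor T p (peakSet K) := by
  refine Extensor.of_contiguous (V' := Unit) (K' := Set.univ) hK (fun _ => ()) (fun _ => v₀)
    (fun _ _ _ => Set.mem_univ _) (fun σ _ hσ => ?_) (fun σ hσ hne => ?_) ?_
  · rwa [Finset.image_const hσ]
  · rw [Finset.image_const (hne.image _), Finset.union_comm]
    exact h σ hσ
  · have mem : ∀ w : Unit → ℝ≥0, 0 < w () → w ∈ peakSet (Set.univ : Set (Finset Unit)) :=
      fun w hw => ⟨w (), hw, {()}, Set.mem_univ _, by simp, fun _ => le_rfl, by simp⟩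
    intro Z A hZ hA hAZ _ a ha haK
    refine exists_extension_of_segment (isOpen_peakSet fun _ _ _ _ _ => Set.mem_univ _) hZ hA ha
      (b := fun _ _ => 1) continuousOn_const (fun z _ => mem _ one_pos) hAZ
      fun z hz μ ν hμν => mem _ ?_
    obtain ⟨M, hM, σ, -, ⟨v, hv⟩, -, hw⟩ := haK hz
    have hz' : 0 < a z () := ((hw v).2 hv).symm ▸ hM
    change 0 < μ * a z () + ν * 1
    rcases eq_or_ne μ 0 with rfl | hμ
    · simp_all
    · exact add_pos_of_pos_of_nonneg (mul_pos (pos_iff_ne_zero.2 hμ) hz') zero_le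

/-- Every point `x` lies in exactly `s x` of the sets `A i`. -/
def ExactCover {n r : ℕ} (s : Fin n → ℕ) (A : Fin r → Finset (Fin n)) : Prop :=
  ∀ x, (univ.filter (fun i => x ∈ A i)).card = s x

theorem ExactCover.exists_of_le {n r : ℕ} {s : Fin n → ℕ} (hs : ∀ x, s x ≤ r)
    (B : Fin r → Finset (Fin n)) (hB : ∀ x, (univ.filter (fun i => x ∈ B i)).card ≤ s x) :
    ∃ A, ExactCover s A ∧ ∀ i, B i ⊆ A i := by
  have h : ∀ x, ∃ t, univ.filter (fun i => x ∈ B i) ⊆ t ∧ t.card = s x := fun x =>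
    Finset.exists_superset_card_eq (hB x) (by simpa using hs x)
  choose t ht hc using h
  refine ⟨fun i => univ.filter (fun x => i ∈ t x), fun x => ?_, fun i x hx => ?_⟩
  · simpa using hc x
  · simpa using ht x (by simpa using hx)

/-- The `j`-th coordinatewise intersection of a collection of tuples. -/
def core {n r : ℕ} (σ : Finset (Fin r → Finset (Fin n))) (j : Fin r) : Finset (Fin n) :=
  univ.filter (fun x => ∀ A ∈ σ, x ∈ A j)

theorem mem_core {n r : ℕ} {σ : Finset (Fin r → Finset (Fin n))} {j : Fin r} {x : Fin n} :
    x ∈ core σ j ↔ ∀ A ∈ σ, x ∈ A j := by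
  simp [core]

theorem core_anti {n r : ℕ} {σ τ : Finset (Fin r → Finset (Fin n))} (h : τ ⊆ σ) (j : Fin r) :
    core σ j ⊆ core τ j := fun _ hx => mem_core.2 fun A hA => mem_core.1 hx A (h hA)

/-- The complex `C_s(n, k, …, k)` on the set of all tuples. -/
def exactComplex {n : ℕ} (r : ℕ) (s : Fin n → ℕ) (k : ℕ) :
    Set (Finset (Fin r → Finset (Fin n))) :=
  {σ | (∀ A ∈ σ, ExactCover s A) ∧ ∀ j, k ≤ (core σ j).card}

theorem exactComplex_down {n r : ℕ} {s : Fin n → ℕ} {k : ℕ} :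
    ∀ σ ∈ exactComplex r s k, ∀ τ ⊆ σ, τ.Nonempty → τ ∈ exactComplex r s k :=
  fun _ hσ _ hτ _ => ⟨fun A hA => hσ.1 A (hτ hA), fun j =>
    (hσ.2 j).trans (Finset.card_le_card (core_anti hτ j))⟩

/-- Collections of exact covers whose first intersection contains `G` and meets `M` in at
least `m` points, the other ones having at least `k` points. -/
def windowComplex {n : ℕ} (r : ℕ) (s : Fin n → ℕ) (k : ℕ) (G M : Finset (Fin n)) (m : ℕ) :
    Set (Finset (Fin (r + 1) → Finset (Fin n))) :=
  {σ | (∀ A ∈ σ, ExactCover s A) ∧ (∀ j : Fin r, k ≤ (core σ j.succ).card) ∧ G ⊆ core σ 0 ∧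
    m ≤ (core σ 0 ∩ M).card}

theorem windowComplex_down {n r : ℕ} {s : Fin n → ℕ} {k : ℕ} {G M : Finset (Fin n)} {m : ℕ} :
    ∀ σ ∈ windowComplex r s k G M m, ∀ τ ⊆ σ, τ.Nonempty → τ ∈ windowComplex r s k G M m :=
  fun _ hσ _ hτ _ => ⟨fun A hA => hσ.1 A (hτ hA), fun j =>
    (hσ.2.1 j).trans (Finset.card_le_card (core_anti hτ _)), hσ.2.2.1.trans (core_anti hτ 0),
    hσ.2.2.2.trans (Finset.card_le_card (Finset.inter_subset_inter_right (core_anti hτ 0)))⟩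

theorem windowComplex_eq_of_card_le_left {n r : ℕ} {s : Fin n → ℕ} {k : ℕ}
    {G M : Finset (Fin n)} {m : ℕ} (hGM : G ⊆ M) (hm : m ≤ G.card) :
    windowComplex r s k G M m = windowComplex r s k G ∅ 0 := by
  ext σ
  refine ⟨fun h => ⟨h.1, h.2.1, h.2.2.1, Nat.zero_le _⟩, fun h => ⟨h.1, h.2.1, h.2.2.1, ?_⟩⟩
  exact hm.trans (Finset.card_le_card (Finset.subset_inter h.2.2.1 hGM))

theorem windowComplex_eq_of_card_eq_right {n r : ℕ} {s : Fin n → ℕ} {k : ℕ}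
    {G M : Finset (Fin n)} {m : ℕ} (hGM : G ⊆ M) (hm : m = M.card) :
    windowComplex r s k G M m = windowComplex r s k M ∅ 0 := by
  ext σ
  refine ⟨fun h => ⟨h.1, h.2.1, ?_, Nat.zero_le _⟩,
    fun h => ⟨h.1, h.2.1, hGM.trans h.2.2.1, ?_⟩⟩
  · exact Finset.inter_eq_right.1
      (Finset.eq_of_subset_of_card_le Finset.inter_subset_right (hm ▸ h.2.2.2))
  · rw [Finset.inter_eq_right.2 h.2.2.1, hm]

theorem windowComplex_union {n r : ℕ} {s : Fin n → ℕ} {k : ℕ} {G M : Finset (Fin n)} {m : ℕ}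
    {y : Fin n} :
    windowComplex r s k G M m =
      windowComplex r s k (insert y G) M m ∪ windowComplex r s k G (M.erase y) m := by
  ext σ
  constructor
  · intro h
    by_cases hyσ : y ∈ core σ 0
    · exact Or.inl ⟨h.1, h.2.1, Finset.insert_subset hyσ h.2.2.1, h.2.2.2⟩
    · refine Or.inr ⟨h.1, h.2.1, h.2.2.1, ?_⟩
      rw [Finset.inter_erase, Finset.erase_eq_of_notMem fun h' => hyσ (Finset.mem_inter.1 h').1]
      exact h.2.2.2
  · rintro (h | h)
    · exact ⟨h.1, h.2.1, (Finset.subset_insert _ _).trans h.2.2.1, h.2.2.2⟩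
    · exact ⟨h.1, h.2.1, h.2.2.1, h.2.2.2.trans
        (Finset.card_le_card (Finset.inter_subset_inter_left (Finset.erase_subset _ _)))⟩

theorem windowComplex_inter {n r : ℕ} {s : Fin n → ℕ} {k : ℕ} {G M : Finset (Fin n)} {m : ℕ}
    {y : Fin n} (hy : y ∈ M) :
    windowComplex r s k (insert y G) M m ∩ windowComplex r s k G (M.erase y) m =
      windowComplex r s k (insert y G) M (m + 1) := by
  ext σ
  have key : y ∈ core σ 0 → (core σ 0 ∩ M.erase y).card + 1 = (core σ 0 ∩ M).card := fun h => by
    rw [Finset.inter_erase, Finset.card_erase_add_one (Finset.mem_inter.2 ⟨h, hy⟩)]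
  constructor
  · rintro ⟨h, h'⟩
    exact ⟨h.1, h.2.1, h.2.2.1, by
      have := key (h.2.2.1 (Finset.mem_insert_self _ _))
      have := h'.2.2.2
      lia⟩
  · intro h
    have h₁ := key (h.2.2.1 (Finset.mem_insert_self _ _))
    have h₂ := h.2.2.2
    exact ⟨⟨h.1, h.2.1, h.2.2.1, by lia⟩,
      ⟨h.1, h.2.1, (Finset.subset_insert _ _).trans h.2.2.1, by lia⟩⟩

theorem ExactCover.mem_of_eq {n r : ℕ} {s : Fin n → ℕ} {A : Fin r → Finset (Fin n)}
    (h : ExactCover s A) {x : Fin n} (hx : s x = r) (j : Fin r) : x ∈ A j := by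
  have := Finset.card_eq_iff_eq_univ (univ.filter fun i => x ∈ A i) |>.1 (by simp [h x, hx])
  simpa using this.ge (Finset.mem_univ j)

theorem ExactCover.ne_zero {n r : ℕ} {s : Fin n → ℕ} {A : Fin r → Finset (Fin n)}
    (h : ExactCover s A) {x : Fin n} {j : Fin r} (hx : x ∈ A j) : s x ≠ 0 := by
  rw [← h x]
  exact Finset.card_ne_zero_of_mem (a := j) (by simpa using hx)

theorem Extensor.windowComplex_fixed {T : Type} [TopologicalSpace T] [NormalSpace T] {n r k : ℕ}
    {s : Fin n → ℕ} (hs : ∀ x, s x ≤ r + 1) {G : Finset (Fin n)} (hG : ∀ x, s x = r + 1 → x ∈ G)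
    (hG' : ∀ x ∈ G, s x ≠ 0) {p : ℕ}
    (ih : ∀ s' : Fin n → ℕ, (∀ x, s' x ≤ r) → p + r * k ≤ ∑ x, s' x + 1 →
      Extensor T p (peakSet (exactComplex r s' k)))
    (hp : p + r * k + G.card ≤ ∑ x, s x + 1) :
    Extensor T p (peakSet (windowComplex r s k G ∅ 0)) := by
  classical
  let s' : Fin n → ℕ := fun x => s x - if x ∈ G then 1 else 0
  have hs'G : ∀ x ∈ G, s' x + 1 = s x := fun x hx => by
    have := Nat.pos_of_ne_zero (hG' x hx)
    simp [s', hx]; lia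
  have hs'n : ∀ x ∉ G, s' x = s x := fun x hx => by simp [s', hx]
  have hs' : ∀ x, s' x ≤ r := fun x => by
    by_cases hx : x ∈ G
    · have := hs'G x hx; have := hs x; lia
    · have := hs'n x hx; have := hs x; have := mt (hG x) hx; lia
  have hsum : ∑ x, s' x + G.card = ∑ x, s x := by
    have : G.card = ∑ x, if x ∈ G then 1 else 0 := by simp
    rw [this, ← Finset.sum_add_distrib]
    refine Finset.sum_congr rfl fun x _ => ?_
    split_ifs with hx
    · exact hs'G x hx
    · exact hs'n x hx
  have hcount : ∀ (A : Fin (r + 1) → Finset (Fin n)) (x : Fin n),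
      (univ.filter fun i => x ∈ A i).card =
        (univ.filter fun j : Fin r => x ∈ A j.succ).card + if x ∈ A 0 then 1 else 0 := by
    intro A x
    rw [Fin.card_filter_univ_succ]
    split_ifs <;> rfl
  have hex : ∀ A : Fin (r + 1) → Finset (Fin n), ∃ A' : Fin r → Finset (Fin n),
      ExactCover s A → G ⊆ A 0 → ExactCover s' A' ∧ ∀ j : Fin r, A j.succ ⊆ A' j := by
    intro A
    by_cases hA : ExactCover s A ∧ G ⊆ A 0
    · obtain ⟨A', h₁, h₂⟩ := ExactCover.exists_of_le hs' (fun j : Fin r => A j.succ) fun x => by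
        have h₁ := hcount A x
        rw [hA.1 x] at h₁
        by_cases hx : x ∈ G
        · have := hs'G x hx
          rw [if_pos (hA.2 hx)] at h₁
          lia
        · have := hs'n x hx
          lia
      exact ⟨A', fun _ _ => ⟨h₁, h₂⟩⟩
    · exact ⟨fun _ => ∅, fun h h' => absurd ⟨h, h'⟩ hA⟩
  choose f hf using hex
  have hface : ∀ σ ∈ windowComplex r s k G ∅ 0, ∀ A ∈ σ,
      ExactCover s' (f A) ∧ ∀ j : Fin r, A j.succ ⊆ f A j := fun σ hσ A hA =>
    hf A (hσ.1 A hA) fun x hx => mem_core.1 (hσ.2.2.1 hx) A hA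
  have hcons : ∀ A', ExactCover s' A' → ExactCover s (Fin.cons G A' : Fin (r + 1) → _) := by
    intro A' h x
    rw [hcount]
    simp only [Fin.cons_succ, Fin.cons_zero, h x]
    split_ifs with hx
    · exact hs'G x hx
    · exact hs'n x hx
  refine Extensor.of_contiguous (K' := exactComplex r s' k) windowComplex_down f
    (fun A' => Fin.cons G A') ?_ ?_ ?_ (ih s' hs' (by lia))
  · intro σ hσ _
    refine ⟨?_, fun j => (hσ.2.1 j).trans (Finset.card_le_card fun x hx => mem_core.2 ?_)⟩
    · simp only [Finset.forall_mem_image]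
      exact fun A hA => (hface σ hσ A hA).1
    · simp only [Finset.forall_mem_image]
      exact fun A hA => (hface σ hσ A hA).2 j (mem_core.1 hx A hA)
  · intro σ hσ _
    refine ⟨?_, fun j => (hσ.2 j).trans (Finset.card_le_card fun x hx => mem_core.2 ?_),
      fun x hx => mem_core.2 ?_, Nat.zero_le _⟩
    · simp only [Finset.forall_mem_image]
      exact fun A hA => hcons A (hσ.1 A hA)
    · simp only [Finset.forall_mem_image, Fin.cons_succ]
      exact fun A hA => mem_core.1 hx A hA
    · simp only [Finset.forall_mem_image, Fin.cons_zero]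
      exact fun _ _ => hx
  · intro σ hσ _
    rw [Finset.image_image]
    refine ⟨?_, fun j => (hσ.2.1 j).trans (Finset.card_le_card fun x hx => mem_core.2 ?_),
      fun x hx => mem_core.2 ?_, Nat.zero_le _⟩ <;>
    simp only [Finset.mem_union, or_imp, forall_and, Finset.forall_mem_image]
    · exact ⟨hσ.1, fun A hA => hcons _ (hface σ hσ A hA).1⟩
    · exact ⟨mem_core.1 hx, fun A hA => (hface σ hσ A hA).2 j (mem_core.1 hx A hA)⟩
    · exact ⟨mem_core.1 (hσ.2.2.1 hx), fun A hA => hx⟩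

theorem Extensor.windowComplex {T : Type} [TopologicalSpace T] [NormalSpace T] {n r k : ℕ}
    {s : Fin n → ℕ} (hs : ∀ x, s x ≤ r + 1)
    (ih : ∀ (p : ℕ) (s' : Fin n → ℕ), (∀ x, s' x ≤ r) → p + r * k ≤ ∑ x, s' x + 1 →
      Extensor T p (peakSet (exactComplex r s' k)))
    (d : ℕ) (G M : Finset (Fin n)) (m p : ℕ) (hd : (M \ G).card = d)
    (hG : ∀ x, s x = r + 1 → x ∈ G) (hM : ∀ x ∈ M, s x ≠ 0) (hGM : G ⊆ M)
    (hGm : G.card ≤ m) (hmM : m ≤ M.card) (hp : p + r * k + m ≤ ∑ x, s x + 1) :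
    Extensor T p (peakSet (windowComplex r s k G M m)) := by
  classical
  induction d generalizing G M m p with
  | zero =>
    have hMG : M ⊆ G := Finset.sdiff_eq_empty_iff_subset.1 (Finset.card_eq_zero.1 hd)
    rw [windowComplex_eq_of_card_le_left hGM (hmM.trans (Finset.card_le_card hMG))]
    exact Extensor.windowComplex_fixed hs hG (fun x hx => hM x (hGM hx)) (ih p) (by lia)
  | succ d ihd =>
    rcases hGm.eq_or_lt with hGm' | hGm'
    · rw [windowComplex_eq_of_card_le_left hGM hGm'.ge]
      exact Extensor.windowComplex_fixed hs hG (fun x hx => hM x (hGM hx)) (ih p) (by lia)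
    rcases hmM.eq_or_lt with hmM' | hmM'
    · rw [windowComplex_eq_of_card_eq_right hGM hmM']
      exact Extensor.windowComplex_fixed hs (fun x hx => hGM (hG x hx)) hM (ih p) (by lia)
    obtain ⟨y, hy⟩ : (M \ G).Nonempty := Finset.card_pos.1 (by lia)
    obtain ⟨hyM, hyG⟩ := Finset.mem_sdiff.1 hy
    have hd₁ : (M \ insert y G).card = d := by
      rw [Finset.sdiff_insert, Finset.card_erase_of_mem hy, hd]; rfl
    have hd₂ : (M.erase y \ G).card = d := by
      rw [Finset.erase_sdiff_comm, Finset.card_erase_of_mem hy, hd]; rfl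
    have hc₁ := Finset.card_insert_of_notMem hyG
    have hc₂ := Finset.card_erase_of_mem hyM
    cases p with
    | zero => exact Extensor.zero _
    | succ p =>
      rw [windowComplex_union (y := y), peakSet_union]
      have hG₁ : ∀ x, s x = r + 1 → x ∈ insert y G := fun x hx =>
        Finset.mem_insert_of_mem (hG x hx)
      have hGM₁ := Finset.insert_subset hyM hGM
      refine Extensor.union (isOpen_peakSet windowComplex_down)
        (isOpen_peakSet windowComplex_down)
        (ihd _ _ _ _ hd₁ hG₁ hM hGM₁ (by lia) hmM hp)
        (ihd _ _ _ _ hd₂ hG (fun x hx => hM x (Finset.mem_of_mem_erase hx))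
          (Finset.subset_erase.2 ⟨hGM, hyG⟩) hGm (by lia) hp) ?_
      rw [← peakSet_inter, windowComplex_inter hyM]
      exact ihd _ _ _ _ hd₁ hG₁ hM hGM₁ (by lia) hmM' (by lia)

theorem Extensor.exactComplex {T : Type} [TopologicalSpace T] [NormalSpace T] {n r k : ℕ}
    {s : Fin n → ℕ} (hs : ∀ x, s x ≤ r) (p : ℕ) (hp : p + r * k ≤ ∑ x, s x + 1) :
    Extensor T p (peakSet (exactComplex r s k)) := by
  classical
  induction r generalizing s p with
  | zero =>
    refine Extensor.of_cone exactComplex_down (fun _ => ∅) ⟨fun A _ x => ?_, fun j => j.elim0⟩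
      (fun σ hσ => ⟨fun A _ x => ?_, fun j => j.elim0⟩) p <;>
    simp [Nat.le_zero.1 (hs x)]
  | succ r ih =>
    let F : Finset (Fin n) := univ.filter fun x => s x = r + 1
    let M : Finset (Fin n) := univ.filter fun x => s x ≠ 0
    have hFM : F ⊆ M := fun x hx => by
      simp only [F, M, Finset.mem_filter_univ] at hx ⊢
      lia
    have hF : ∀ x, s x = r + 1 → x ∈ F := by simp [F]
    have hM : ∀ x ∈ M, s x ≠ 0 := by simp [M]
    have hFA : ∀ A : Fin (r + 1) → Finset (Fin n), ExactCover s A → ∀ j, F ⊆ A j :=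
      fun A hA j x hx => hA.mem_of_eq (by simpa [F] using hx) j
    rcases le_or_gt k F.card with hkF | hkF
    · obtain ⟨A₀, hA₀, -⟩ := ExactCover.exists_of_le hs (fun _ => ∅) (by simp)
      have hA₀c : ∀ A ∈ ({A₀} : Finset _), ExactCover s A := by simpa using hA₀
      have hle : ∀ σ : Finset (Fin (r + 1) → Finset (Fin n)), (∀ A ∈ σ, ExactCover s A) →
          σ ∈ _root_.exactComplex (r + 1) s k := fun σ hσ => ⟨hσ, fun j =>
        hkF.trans (Finset.card_le_card fun x hx => mem_core.2 fun A hA => hFA A (hσ A hA) j hx)⟩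
      refine Extensor.of_cone exactComplex_down A₀ (hle _ hA₀c) (fun σ hσ => hle _ ?_) p
      simpa using ⟨hA₀, hσ.1⟩
    rcases lt_or_ge M.card k with hkM | hkM
    · have h₁ : ∑ x, s x ≤ M.card * (r + 1) := by
        rw [← smul_eq_mul, ← Finset.sum_filter_ne_zero]
        exact Finset.sum_le_card_nsmul _ _ _ fun x _ => hs x
      have h₂ : M.card * (r + 1) + (r + 1) ≤ (r + 1) * k := by
        rw [← Nat.succ_mul, mul_comm]
        exact Nat.mul_le_mul_left _ hkM
      cases p with
      | zero => exact Extensor.zero _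
      | succ p =>
        cases r with
        | zero => lia
        | succ r => lia
    · rw [peakSet_congr (L := _root_.windowComplex r s k F M k)]
      · refine Extensor.windowComplex hs (fun p s' hs' => ih hs' p) _ _ _ _ _ rfl hF hM hFM
          hkF.le hkM ?_
        rw [Nat.succ_mul] at hp
        lia
      · rintro σ ⟨A₁, hA₁⟩
        constructor
        · intro h
          have h' : core σ 0 ⊆ M := fun x hx => by
            simpa [M] using (h.1 A₁ hA₁).ne_zero (mem_core.1 hx A₁ hA₁)
          exact ⟨h.1, fun j => h.2 _, fun x hx => mem_core.2 fun A hA => hFA A (h.1 A hA) 0 hx,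
            by rw [Finset.inter_eq_left.2 h']; exact h.2 0⟩
        · intro h
          exact ⟨h.1, Fin.cases (h.2.2.2.trans (Finset.card_le_card Finset.inter_subset_left))
            h.2.1⟩

theorem exists_finset_disjoint_separating (Q : Finset ℝ) {δ : ℝ} (hδ : 0 < δ) :
    ∃ Q' : Finset ℝ, Disjoint Q Q' ∧
      ∀ u v, 0 ≤ u → v ≤ 1 → u + δ ≤ v → ∃ q ∈ Q', u < q ∧ q < v := by
  obtain ⟨N, hN⟩ := exists_nat_gt (2 / δ)
  have hN₀ : (0 : ℝ) < N := (by positivity : 0 ≤ 2 / δ).trans_lt hN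
  have hq : ∀ k : ℕ, ∃ q ∈ Set.Ioo ((k : ℝ) / N) ((k + 1 : ℝ) / N), q ∉ Q := fun k =>
    (Set.Ioo_infinite (by gcongr; linarith)).exists_notMem_finset Q
  choose q hqI hqQ using hq
  refine ⟨(Finset.range N).image q, ?_, fun u v hu hv huv => ?_⟩
  · rw [Finset.disjoint_right]
    simp only [Finset.forall_mem_image]
    exact fun k _ => hqQ k
  · have hδN : 2 < N * δ := by rwa [div_lt_iff₀ hδ] at hN
    have h₁ := Nat.floor_le (mul_nonneg hu hN₀.le)
    have h₂ := Nat.lt_floor_add_one (u * N)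
    have h₃ : v * N ≤ N := mul_le_of_le_one_left hN₀.le hv
    have h₄ : (u + δ) * N ≤ v * N := by gcongr
    obtain ⟨hl, hr⟩ := hqI (⌊u * N⌋₊ + 1)
    rw [div_lt_iff₀ hN₀] at hl
    rw [lt_div_iff₀ hN₀] at hr
    push_cast at hl hr
    refine ⟨q (⌊u * N⌋₊ + 1), Finset.mem_image_of_mem _ (Finset.mem_range.2 ?_), ?_, ?_⟩
    · have : ((⌊u * N⌋₊ + 1 : ℕ) : ℝ) < N := by push_cast; linarith
      exact_mod_cast this
    · exact lt_of_mul_lt_mul_right (h₂.trans hl) hN₀.le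
    · exact lt_of_mul_lt_mul_right (a := (N : ℝ)) (by linarith) hN₀.le

theorem dimLT_of_subset_Icc {ι : Type*} [Fintype ι] (p : ℕ) (Q : Finset ℝ) (Z : Set (ι → ℝ))
    (hZ : Z ⊆ Set.Icc 0 1)
    (h : ∀ x ∈ Z, Fintype.card ι + 1 ≤ p + (univ.filter fun i => x i ∈ Q).card) : DimLT p Z := by
  classical
  induction p generalizing Q Z with
  | zero =>
    refine Set.eq_empty_iff_forall_notMem.2 fun x hx => ?_
    have := h x hx
    have := (univ.filter fun i => x i ∈ Q).card_le_univ
    lia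
  | succ p ih =>
    intro E F hE hF hEF
    set C : Set (ι → ℝ) := Set.Icc 0 1 with hC
    have hCc : IsCompact C := isCompact_Icc
    obtain ⟨δ, hδ, hδEF⟩ := Metric.exists_pos_forall_lt_edist (hCc.inter_left hE)
      (hF.inter hCc.isClosed) (hEF.mono Set.inter_subset_left Set.inter_subset_left)
    obtain ⟨Q', hQQ', hQ'⟩ := exists_finset_disjoint_separating Q (NNReal.coe_pos.2 hδ)
    let R : (ι → ℝ) → (ι → ℝ) → Prop := fun x y =>
      ∀ i, ∀ q ∈ Q', ¬ (x i < q ∧ q < y i) ∧ ¬ (y i < q ∧ q < x i)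
    let N : (ι → ℝ) → Set (ι → ℝ) := fun y =>
      {x | ∀ i, ∀ q ∈ Q', (y i < q → x i < q) ∧ (q < y i → q < x i)}
    have hN : ∀ y, N y ∈ 𝓝 y := by
      intro y
      simp only [N, Filter.eventually_all, Filter.eventually_all_finset, Filter.eventually_and,
        ← Filter.Eventually.eq_1]
      exact fun i q _ => ⟨fun hy => (continuous_apply i).continuousAt.eventually_lt_const hy,
        fun hy => (continuous_apply i).continuousAt.eventually_const_lt hy⟩
    let Z₂ : Set (ι → ℝ) := {x | x ∈ C ∧ ∃ y ∈ F ∩ C, R x y}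
    have hZ₂ : IsClosed Z₂ := by
      have hR : IsClosed {z : (ι → ℝ) × (ι → ℝ) | R z.1 z.2} := by
        simp only [R, Set.ofPred_forall, Set.ofPred_and]
        refine isClosed_iInter fun i => isClosed_iInter fun q => isClosed_iInter fun _ => ?_
        refine IsClosed.inter ?_ ?_ <;> rw [← isOpen_compl_iff] <;>
        simp only [Set.compl_ofPred, not_not, Set.ofPred_and] <;>
        exact (isOpen_lt (by fun_prop) (by fun_prop)).inter (isOpen_lt (by fun_prop) (by fun_prop))
      have : Z₂ = Prod.fst '' ((C ×ˢ (F ∩ C)) ∩ {z : (ι → ℝ) × (ι → ℝ) | R z.1 z.2}) := by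
        ext x
        constructor
        · rintro ⟨hx, y, hy, hxy⟩
          exact ⟨(x, y), ⟨⟨hx, hy⟩, hxy⟩, rfl⟩
        · rintro ⟨⟨x, y⟩, ⟨⟨hx, hy⟩, hxy⟩, rfl⟩
          exact ⟨hx, y, hy, hxy⟩
      rw [this]
      exact (((hCc.prod (hCc.inter_left hF)).inter_right hR).image continuous_fst).isClosed
    have hZ₁C : closure (C \ Z₂) ⊆ C := closure_minimal Set.sdiff_subset hCc.isClosed
    refine ⟨closure (C \ Z₂), Z₂, isClosed_closure, hZ₂, fun x hx => ?_, ?_, ?_, ?_⟩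
    · by_cases hx₂ : x ∈ Z₂
      · exact Or.inr hx₂
      · exact Or.inl (subset_closure ⟨hZ hx, hx₂⟩)
    · refine Set.disjoint_left.2 fun y hy hyF => ?_
      obtain ⟨x, hx, hxC, hxZ⟩ := mem_closure_iff_nhds.1 hy _ (hN y)
      refine hxZ ⟨hxC, y, ⟨hyF, hZ₁C hy⟩, fun i q hq => ?_⟩
      have := hx i q hq
      grind
    · refine Set.disjoint_left.2 fun x hx hxE => ?_
      obtain ⟨hxC, y, hy, hxy⟩ := hx
      refine (hδEF x ⟨hxE, hxC⟩ y hy).not_ge ?_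
      rw [edist_nndist, ENNReal.coe_le_coe, ← NNReal.coe_le_coe, coe_nndist]
      refine (dist_pi_le_iff δ.coe_nonneg).2 fun i => ?_
      rw [Real.dist_eq, abs_le]
      by_contra hcon
      rw [not_and_or, not_le, not_le] at hcon
      rcases hcon with hcon | hcon
      · obtain ⟨q, hq, h₁, h₂⟩ := hQ' (x i) (y i) (hxC.1 i) (hy.2.2 i) (by linarith)
        exact (hxy i q hq).1 ⟨h₁, h₂⟩
      · obtain ⟨q, hq, h₁, h₂⟩ := hQ' (y i) (x i) (hy.2.1 i) (hxC.2 i) (by linarith)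
        exact (hxy i q hq).2 ⟨h₁, h₂⟩
    · refine ih (Q ∪ Q') _ (Set.inter_subset_left.trans hZ) fun x hx => ?_
      obtain ⟨hxZ, hx₁, -, y, hy, hxy⟩ := hx
      obtain ⟨i, hi⟩ : ∃ i, x i ∈ Q' := by
        by_contra! hcon
        obtain ⟨x', hx', hxC, hxZ₂⟩ := mem_closure_iff_nhds.1 hx₁ _ (hN x)
        refine hxZ₂ ⟨hxC, y, hy, fun i q hq => ?_⟩
        have h₁ := hx' i q hq
        have h₂ := hxy i q hq
        have h₃ : x i ≠ q := fun h => hcon i (h ▸ hq)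
        rcases h₃.lt_or_gt with h₃ | h₃ <;> grind
      have hlt : (univ.filter fun i => x i ∈ Q).card < (univ.filter fun i => x i ∈ Q ∪ Q').card := by
        refine Finset.card_lt_card ⟨fun j hj => ?_, fun hsub => ?_⟩
        · simp only [Finset.mem_filter_univ, Finset.mem_union] at hj ⊢
          exact Or.inl hj
        · have := @hsub i (by simp [hi])
          exact Finset.disjoint_right.1 hQQ' hi (by simpa using this)
      have := h x hxZ
      lia

theorem dimLT_Icc {ι : Type*} [Fintype ι] :
    DimLT (Fintype.card ι + 1) (Set.Icc (0 : ι → ℝ) 1) :=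
  dimLT_of_subset_Icc _ ∅ _ subset_rfl fun _ _ => Nat.le_add_right _ _

theorem Extensor.nonempty {Y : Type*} [TopologicalSpace Y] [Nonempty Y] {X : Set Y}
    (h : Extensor (Fin 0 → ℝ) 1 X) : X.Nonempty := by
  obtain ⟨b, -, hb, -⟩ := h (Set.Icc 0 1) ∅ isClosed_Icc isClosed_empty (Set.empty_subset _)
    dimLT_Icc (fun _ => Classical.arbitrary Y) (continuousOn_empty _) (Set.mapsTo_empty _ _)
  exact ⟨b 0, hb ⟨le_rfl, fun i => i.elim0⟩⟩

theorem Extensor.subsingleton_homotopyGroup {Y : Type*} [TopologicalSpace Y] {X : Set Y} {i : ℕ}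
    (h : Extensor (Fin (i + 1) → ℝ) (i + 2) X) (x : X) : Subsingleton (π_ i X x) := by
  refine ⟨fun α β => ?_⟩
  induction α using Quotient.inductionOn with | _ f
  induction β using Quotient.inductionOn with | _ g
  refine Quotient.sound ?_
  let P : (Fin (i + 1) → ℝ) → Fin i → unitInterval := fun z j =>
    Set.projIcc 0 1 zero_le_one (z j.succ)
  have hP : Continuous P := continuous_pi fun j => continuous_projIcc.comp (continuous_apply _)
  have hPb : ∀ z, (∃ j : Fin i, z j.succ = 0 ∨ z j.succ = 1) → P z ∈ Cube.boundary (Fin i) := by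
    rintro z ⟨j, hj | hj⟩
    · exact ⟨j, Or.inl (by simp [P, hj])⟩
    · exact ⟨j, Or.inr (by simp [P, hj])⟩
  let C : Set (Fin (i + 1) → ℝ) := Set.Icc 0 1
  let S₁ : Set (Fin (i + 1) → ℝ) := C ∩ {z | z 0 = 0}
  let S₂ : Set (Fin (i + 1) → ℝ) := C ∩ {z | z 0 = 1 ∨ ∃ j : Fin i, z j.succ = 0 ∨ z j.succ = 1}
  have hS₁ : IsClosed S₁ :=
    isClosed_Icc.inter (isClosed_eq (continuous_apply 0) continuous_const)
  have hS₂ : IsClosed S₂ := by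
    refine isClosed_Icc.inter ?_
    simp only [Set.ofPred_or, Set.ofPred_exists]
    exact (isClosed_eq (by fun_prop) (by fun_prop)).union (isClosed_iUnion_of_finite fun j =>
      (isClosed_eq (by fun_prop) (by fun_prop)).union (isClosed_eq (by fun_prop) (by fun_prop)))
  obtain ⟨a, ha, ha₁, ha₂⟩ := exists_continuousOn_union hS₁ hS₂
    (f₁ := fun z => (f (P z) : Y)) (f₂ := fun z => (g (P z) : Y))
    (continuous_subtype_val.comp (f.1.continuous.comp hP)).continuousOn
    (continuous_subtype_val.comp (g.1.continuous.comp hP)).continuousOn (by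
      rintro z ⟨⟨-, hz₀⟩, -, hz₁ | hz₁⟩
      · exact absurd (hz₀.symm.trans hz₁) zero_ne_one
      · simp only [f.2 _ (hPb z hz₁), g.2 _ (hPb z hz₁), ← GenLoop.coe_coe])
  obtain ⟨b, hb, hbX, hba⟩ := h C (S₁ ∪ S₂) isClosed_Icc (hS₁.union hS₂)
    (Set.union_subset Set.inter_subset_left Set.inter_subset_left)
    (by simpa using dimLT_Icc (ι := Fin (i + 1))) a ha (by
      rintro z (hz | hz)
      · exact ha₁ hz ▸ (f (P z)).2
      · exact ha₂ hz ▸ (g (P z)).2)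
  let e : unitInterval × (Fin i → unitInterval) → Fin (i + 1) → ℝ := fun q =>
    Fin.cons (q.1 : ℝ) fun j => (q.2 j : ℝ)
  have he : Continuous e := by
    refine Continuous.finCons (by fun_prop) (by fun_prop)
  have heC : ∀ q, e q ∈ C := fun q =>
    ⟨Fin.cases q.1.2.1 fun j => (q.2 j).2.1, Fin.cases q.1.2.2 fun j => (q.2 j).2.2⟩
  have hPe : ∀ q, P (e q) = q.2 := fun q => funext fun j => by simp [P, e]
  have hb₁ : ∀ y, b (e (0, y)) = f y := fun y => by
    have : e (0, y) ∈ S₁ := ⟨heC _, by simp [e]⟩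
    rw [hba (Or.inl this), ha₁ this]
    simp only [hPe]
  have hb₂ : ∀ q : unitInterval × (Fin i → unitInterval),
      (q.1 = 1 ∨ q.2 ∈ Cube.boundary (Fin i)) → b (e q) = g q.2 := fun q hq => by
    have : e q ∈ S₂ := by
      refine ⟨heC _, hq.imp (fun h => by simp [e, h]) ?_⟩
      rintro ⟨j, hj⟩
      exact ⟨j, hj.imp (fun h => by simp [e, h]) fun h => by simp [e, h]⟩
    rw [hba (Or.inr this), ha₂ this]
    simp only [hPe]
  refine ⟨⟨⟨⟨fun q => ⟨b (e q), hbX (heC q)⟩, ?_⟩, fun y => ?_, fun y => ?_⟩, fun t y hy => ?_⟩⟩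
  · exact (hb.comp_continuous he heC).subtype_mk _
  · exact Subtype.ext (hb₁ y)
  · exact Subtype.ext (hb₂ _ (Or.inl rfl))
  · refine Subtype.ext ((hb₂ _ (Or.inr hy)).trans ?_)
    simp only [f.2 y hy]
    exact congrArg Subtype.val (g.2 y hy)

theorem Extensor.of_retract {T : Type*} [TopologicalSpace T] {Y Y' : Type*} [TopologicalSpace Y]
    [TopologicalSpace Y'] {X : Set Y} {X' : Set Y'} {p : ℕ} (h : Extensor T p X) {e : Y' → Y}
    {ρ : Y → Y'} (he : ContinuousOn e X') (heX : Set.MapsTo e X' X) (hρ : ContinuousOn ρ X)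
    (hρX : Set.MapsTo ρ X X') (hρe : Set.LeftInvOn ρ e X') : Extensor T p X' := by
  intro Z A hZ hA hAZ hdim a ha haX
  obtain ⟨b, hb, hbX, hba⟩ := h Z A hZ hA hAZ hdim (e ∘ a) (he.comp ha haX) (heX.comp haX)
  refine ⟨ρ ∘ b, hρ.comp hb hbX, hρX.comp hbX, fun z hz => ?_⟩
  simp only [Function.comp_apply, hba hz, hρe (haX hz)]

open Classical in
/-- The largest value of `min_σ w` over the non-empty non-faces `σ` of `K`. -/
noncomputable def nonfaceLevel {V : Type*} [Fintype V] (K : Set (Finset V)) (w : V → ℝ≥0) : ℝ≥0 :=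
  (univ.filter fun σ : Finset V => σ ∉ K).sup
    fun σ => if h : σ.Nonempty then σ.inf' h w else 0

theorem continuous_nonfaceLevel {V : Type*} [Fintype V] (K : Set (Finset V)) :
    Continuous (nonfaceLevel K) := by
  refine Continuous.finset_sup_apply fun σ _ => ?_
  split_ifs with h
  · exact Continuous.finset_inf'_apply h fun v _ => continuous_apply v
  · exact continuous_const

theorem le_nonfaceLevel {V : Type*} [Fintype V] {K : Set (Finset V)} {σ : Finset V} (hσ : σ ∉ K)
    (hne : σ.Nonempty) (w : V → ℝ≥0) : σ.inf' hne w ≤ nonfaceLevel K w := by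
  classical
  have := Finset.le_sup (s := univ.filter fun σ : Finset V => σ ∉ K)
    (f := fun σ : Finset V => if h : σ.Nonempty then σ.inf' h w else 0)
    (Finset.mem_filter.2 ⟨Finset.mem_univ σ, hσ⟩)
  rwa [dif_pos hne] at this

theorem nonfaceLevel_le {V : Type*} [Fintype V] {K : Set (Finset V)} {w : V → ℝ≥0} {c : ℝ≥0}
    (h : ∀ σ ∉ K, σ.Nonempty → ∃ v ∈ σ, w v ≤ c) : nonfaceLevel K w ≤ c := by
  classical
  refine Finset.sup_le fun σ hσ => ?_
  split_ifs with hne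
  · obtain ⟨v, hv, hvc⟩ := h σ (Finset.mem_filter.1 hσ).2 hne
    exact (Finset.inf'_le _ hv).trans hvc
  · exact zero_le

theorem nonfaceLevel_lt {V : Type*} [Fintype V] {K : Set (Finset V)} {w : V → ℝ≥0} {c : ℝ≥0}
    (hc : 0 < c) (h : ∀ σ ∉ K, σ.Nonempty → ∃ v ∈ σ, w v < c) : nonfaceLevel K w < c := by
  classical
  refine (Finset.sup_lt_iff hc).2 fun σ hσ => ?_
  split_ifs with hne
  · obtain ⟨v, hv, hvc⟩ := h σ (Finset.mem_filter.1 hσ).2 hne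
    exact (Finset.inf'_le _ hv).trans_lt hvc
  · exact hc

theorem Extensor.realization {T : Type} [TopologicalSpace T] {V : Type*} [Fintype V]
    {K : Set (Finset V)} (hK : ∀ σ ∈ K, ∀ τ ⊆ σ, τ.Nonempty → τ ∈ K) {p : ℕ}
    (h : Extensor T p (peakSet K)) :
    Extensor T p {w : V → ℝ | (∃ s ∈ K, ∀ v, w v ≠ 0 → v ∈ s) ∧ (∀ v, 0 ≤ w v) ∧
      ∑ᶠ v, w v = 1} := by
  classical
  let e : (V → ℝ) → V → ℝ≥0 := fun x v => (x v).toNNReal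
  let D : (V → ℝ≥0) → V → ℝ := fun w v => ((w v - nonfaceLevel K w : ℝ≥0) : ℝ)
  let ρ : (V → ℝ≥0) → V → ℝ := fun w v => D w v / ∑ u, D w u
  have hD : ∀ v, Continuous fun w => D w v := fun v => by
    have := continuous_nonfaceLevel K
    exact NNReal.continuous_coe.comp ((continuous_apply v).sub this)
  have hD₀ : ∀ w v, 0 ≤ D w v := fun w v => NNReal.coe_nonneg _
  have hDpos : ∀ w v, 0 < D w v ↔ nonfaceLevel K w < w v := fun w v => by
    simp only [D, NNReal.coe_pos, tsub_pos_iff_lt]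
  have hsum : ∀ w ∈ peakSet K, 0 < ∑ u, D w u := by
    rintro w ⟨M, hM, σ, hσ, ⟨v, hv⟩, hw, hw'⟩
    refine Finset.sum_pos' (fun u _ => hD₀ w u) ⟨v, Finset.mem_univ v, ?_⟩
    rw [hDpos, (hw' v).2 hv]
    refine nonfaceLevel_lt hM fun τ hτ hne => ?_
    by_contra! hcon
    exact hτ (hK σ hσ τ (fun u hu => (hw' u).1 (le_antisymm (hw u) (hcon u hu))) hne)
  refine h.of_retract (e := e) (ρ := ρ) ?_ ?_ ?_ ?_ ?_
  · exact (continuous_pi fun v => continuous_real_toNNReal.comp (continuous_apply v)).continuousOn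
  · rintro x ⟨⟨t, ht, hxt⟩, hx₀, hx₁⟩
    rw [finsum_eq_sum_of_fintype] at hx₁
    obtain ⟨u, -, hu⟩ : ∃ u ∈ univ, x u ≠ 0 :=
      Finset.exists_ne_zero_of_sum_ne_zero (by rw [hx₁]; exact one_ne_zero)
    obtain ⟨m, -, hm⟩ := Finset.exists_max_image univ (e x) ⟨u, Finset.mem_univ u⟩
    have hm₀ : 0 < e x m := (Real.toNNReal_pos.2 ((hx₀ u).lt_of_ne' hu)).trans_le
      (hm u (Finset.mem_univ u))
    refine ⟨e x m, hm₀, univ.filter fun v => e x v = e x m, hK t ht _ (fun v hv => ?_) ⟨m, by simp⟩,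
      ⟨m, by simp⟩, fun v => hm v (Finset.mem_univ v), by simp⟩
    refine hxt v fun h0 => hm₀.ne ?_
    rw [← (Finset.mem_filter.1 hv).2]
    simp [e, h0]
  · exact continuousOn_pi.2 fun v => (hD v).continuousOn.div
      (continuous_finsetSum _ fun u _ => hD u).continuousOn fun w hw => (hsum w hw).ne'
  · intro w hw
    refine ⟨⟨univ.filter fun v => nonfaceLevel K w < w v, ?_, fun v hv => ?_⟩,
      fun v => div_nonneg (hD₀ w v) (hsum w hw).le, ?_⟩
    · by_contra hcon
      obtain ⟨v, -, hv⟩ := Finset.exists_lt_of_sum_lt (s := univ) (f := fun _ => (0 : ℝ)) (g := D w)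
        (by simpa using hsum w hw)
      have hne : (univ.filter fun v => nonfaceLevel K w < w v).Nonempty :=
        ⟨v, by simpa using (hDpos w v).1 hv⟩
      obtain ⟨u, hu, hue⟩ := Finset.exists_mem_eq_inf' hne w
      exact ((le_nonfaceLevel hcon hne w).trans_lt (Finset.mem_filter.1 hu).2).ne hue
    · rw [Finset.mem_filter_univ, ← hDpos]
      exact (hD₀ w v).lt_of_ne' fun h0 => hv (by simp [ρ, h0])
    · rw [finsum_eq_sum_of_fintype, ← Finset.sum_div, div_self (hsum w hw).ne']
  · rintro x ⟨⟨t, ht, hxt⟩, hx₀, hx₁⟩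
    rw [finsum_eq_sum_of_fintype] at hx₁
    have hl : nonfaceLevel K (e x) = 0 := by
      refine le_antisymm (nonfaceLevel_le fun σ hσ hne => ?_) zero_le
      by_contra! hcon
      exact hσ (hK t ht σ (fun v hv => hxt v (Real.toNNReal_pos.1 (hcon v hv)).ne') hne)
    have hDx : ∀ v, D (e x) v = x v := fun v => by simp [D, hl, e, hx₀ v]
    funext v
    simp only [ρ, hDx, hx₁, div_one]

noncomputable instance {n r : ℕ} {s : Fin n → ℕ} {k : Fin r → ℕ} : Fintype (CsVert n r s k) := by
  classical
  exact inferInstanceAs (Fintype {A : Fin r → Finset (Fin n) // (∀ i, k i ≤ (A i).card) ∧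
    ∀ x : Fin n, (Finset.univ.filter (fun i => x ∈ A i)).card = s x})

theorem csFace_down {n r : ℕ} {s : Fin n → ℕ} {k : Fin r → ℕ} :
    ∀ σ ∈ {σ | CsFace n r s k σ}, ∀ τ ⊆ σ, τ.Nonempty → τ ∈ {σ | CsFace n r s k σ} :=
  fun _ hσ _ hτ _ j => (hσ j).trans (Finset.card_le_card (Finset.inf_mono hτ))

theorem Extensor.csFace {T : Type} [TopologicalSpace T] [NormalSpace T] {n r k p : ℕ}
    {s : Fin n → ℕ} (hs : ∀ x, s x ≤ r) (hsum : r * k ≤ ∑ x, s x)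
    (hp : p + r * k ≤ ∑ x, s x + 1) :
    Extensor T p (peakSet {σ | CsFace n r s (fun _ => k) σ}) := by
  classical
  have hmem : ∀ σ ∈ _root_.exactComplex r s k, ∀ A ∈ σ, (∀ i, k ≤ (A i).card) ∧
      ∀ x : Fin n, (Finset.univ.filter (fun i => x ∈ A i)).card = s x := fun σ hσ A hA =>
    ⟨fun i => (hσ.2 i).trans (Finset.card_le_card fun x hx => mem_core.1 hx A hA), hσ.1 A hA⟩
  obtain ⟨-, -, -, σ₀, hσ₀, ⟨A₀, hA₀⟩, -⟩ :=
    (Extensor.exactComplex (T := Fin 0 → ℝ) (k := k) hs 1 (by lia)).nonempty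
  let g : (Fin r → Finset (Fin n)) → CsVert n r s (fun _ => k) := fun A =>
    if h : (∀ i, k ≤ (A i).card) ∧
      ∀ x : Fin n, (Finset.univ.filter (fun i => x ∈ A i)).card = s x then ⟨A, h⟩
    else ⟨A₀, hmem σ₀ hσ₀ A₀ hA₀⟩
  have hg : ∀ A, g A.1 = A := fun A => dif_pos A.2
  refine Extensor.of_contiguous csFace_down (fun A => A.1) g ?_ ?_ ?_
    (Extensor.exactComplex hs p hp)
  · intro σ hσ _
    refine ⟨?_, fun j => (hσ j).trans (Finset.card_le_card fun x hx => mem_core.2 ?_)⟩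
    · simp only [Finset.forall_mem_image]
      exact fun A _ => A.2.2
    · simp only [Finset.forall_mem_image]
      exact fun A hA => Finset.inf_le (f := fun A : CsVert n r s _ => A.1 j) hA hx
  · intro σ hσ _ j
    refine (hσ.2 j).trans (Finset.card_le_card (Finset.le_inf ?_))
    simp only [Finset.forall_mem_image]
    intro A hA x hx
    rw [show g A = ⟨A, hmem σ hσ A hA⟩ from dif_pos _]
    exact mem_core.1 hx A hA
  · intro σ hσ _
    rwa [Finset.image_image, show g ∘ (fun A => A.1) = id from funext hg, Finset.image_id,
      Finset.union_self]

/-- `C_s(n,k,…,k)` (`k` repeated `r` times) is `(s(1)+⋯+s(n) - rk - 1)`-connected. -/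
theorem Cs_connectivity (n r k : ℕ) (s : Fin n → ℕ)
    (hr : 1 ≤ r) (hs : ∀ x, s x ≤ r) (hsum : r * k ≤ ∑ x, s x) :
    IsNConnected ((∑ x, s x : ℤ) - r * k - 1)
      (realization {σ | CsFace n r s (fun _ => k) σ}) := by
  have key : ∀ i p : ℕ, p + r * k ≤ ∑ x, s x + 1 → Extensor (Fin i → ℝ) p _ := fun i p hp =>
    (Extensor.csFace (T := Fin i → ℝ) hs hsum hp).realization csFace_down
  refine ⟨fun _ => (key 0 1 (by lia)).nonempty.to_subtype, fun i hi x => ?_⟩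
  refine (key (i + 1) (i + 2) ?_).subsingleton_homotopyGroup x
  zify
  lia
end
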